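/- arXiv:2102.02323 — 2 statements merged into one kernel-verified Lean document; each statement's English description precedes it below -/
import Mathlib

section
/- Let k ≥ d ≥ 2 be integers and let E ⊂ ℝ^d be a compact set with Hausdorff dimension dimH E > d − 1 + 1/d. Then the set C_{k,d}(E) = {(det(x^j, x^{j+1}, …, x^{j+d−1}))_{1 ≤ j ≤ k+1−d} : x^1,…,x^k ∈ E} ⊂ ℝ^{k+1−d} of chains of volumes determined by E has positive (k+1−d)-dimensional Lebesgue measure. -/
open MeasureTheory Metric

noncomputable section

/-- The determinant of the `d × d` matrix with columns `x 0, …, x (d-1)`. -/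
def detCols {d : ℕ} (x : Fin d → EuclideanSpace ℝ (Fin d)) : ℝ :=
  Matrix.det (Matrix.of fun l i => x i l)

open scoped ENNReal RealInnerProductSpace

theorem exists_consistent_measures_le_outerMeasure {X ι : Type*} [Countable ι] [MeasurableSpace ι]
    [DiscreteMeasurableSpace ι] (F : OuterMeasure X) (E : Set X) (c : ℕ → X → ι) (p : ι → ι)
    (hp : ∀ n x, p (c (n + 1) x) = c n x) (hfin : ∀ q, (p ⁻¹' {q}).Finite)
    (hF : ∀ n q, F (E ∩ c n ⁻¹' {q}) ≠ ∞) (q₀ : ι) :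
    ∃ M : ℕ → Measure ι, M 0 = F (E ∩ c 0 ⁻¹' {q₀}) • Measure.dirac q₀ ∧
      (∀ n q, M n {q} ≤ F (E ∩ c n ⁻¹' {q})) ∧ ∀ n, (M (n + 1)).map p = M n := by
  classical
  let φ : ℕ → ι → ℝ≥0∞ := fun n q => F (E ∩ c n ⁻¹' {q})
  let S : ℕ → ι → ℝ≥0∞ := fun n q => ∑' q' : p ⁻¹' {q}, φ (n + 1) q'
  have hS : ∀ n q, S n q ≠ ∞ := by
    intro n q
    have := (hfin q).to_subtype
    have := Fintype.ofFinite (p ⁻¹' {q})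
    simp only [S, tsum_fintype]
    exact ENNReal.sum_ne_top.2 fun a _ => hF _ _
  have hφS : ∀ n q, φ n q ≤ S n q := by
    intro n q
    refine (measure_mono (μ := F) ?_).trans (measure_iUnion_le
      (fun q' : p ⁻¹' {q} => E ∩ c (n + 1) ⁻¹' {(q' : ι)}))
    rintro x ⟨hx, hxq⟩
    simp only [Set.mem_preimage, Set.mem_singleton_iff] at hxq
    exact Set.mem_iUnion.2 ⟨⟨c (n + 1) x, by simp [hp, hxq]⟩, hx, rfl⟩
  let M : ℕ → Measure ι := fun n => Nat.rec (φ 0 q₀ • Measure.dirac q₀)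
    (fun n m => Measure.sum fun q' =>
      (m {p q'} * φ (n + 1) q' / S n (p q')) • Measure.dirac q') n
  have hM : ∀ n q', M (n + 1) {q'} = M n {p q'} * φ (n + 1) q' / S n (p q') := by
    intro n q'
    change (Measure.sum fun q' => (M n {p q'} * φ (n + 1) q' / S n (p q')) • Measure.dirac q') {q'}
      = _
    rw [Measure.sum_apply _ (measurableSet_singleton _), tsum_eq_single q']
    · simp
    · intro b hb
      simp [hb]
  have hle : ∀ n q, M n {q} ≤ φ n q := by
    intro n
    induction n with
    | zero =>
      intro q
      change (φ 0 q₀ • Measure.dirac q₀) {q} ≤ φ 0 q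
      by_cases h : q₀ = q
      · subst h; simp
      · simp [h]
    | succ n ih =>
      intro q
      rw [hM]
      apply ENNReal.div_le_of_le_mul
      rw [mul_comm]
      gcongr
      exact (ih _).trans (hφS _ _)
  refine ⟨M, rfl, hle, fun n => ?_⟩
  refine Measure.ext_of_singleton fun q => ?_
  rw [Measure.map_apply (measurable_of_countable _) (measurableSet_singleton _),
    ← Measure.tsum_indicator_apply_singleton _ _ (.of_discrete), ← tsum_subtype]
  have : ∀ q' : p ⁻¹' {q}, M (n + 1) {(q' : ι)} = (M n {q} / S n q) * φ (n + 1) q' := by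
    rintro ⟨q', hq'⟩
    simp only [Set.mem_preimage, Set.mem_singleton_iff] at hq'
    rw [hM, hq', div_eq_mul_inv, div_eq_mul_inv, mul_right_comm]
  simp_rw [this]
  rw [ENNReal.tsum_mul_left]
  change M n {q} / S n q * S n q = _
  by_cases h0 : S n q = 0
  · have : M n {q} = 0 := by
      have := (hle n q).trans (hφS n q)
      rw [h0] at this
      exact le_antisymm this bot_le
    simp [this]
  · exact ENNReal.div_mul_cancel h0 (hS n q)

theorem exists_probabilityMeasure_le_outerMeasure {X ι : Type*} [MetricSpace X]
    [MeasurableSpace X] [BorelSpace X] [Countable ι] [MeasurableSpace ι]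
    [DiscreteMeasurableSpace ι] (F : OuterMeasure X) {E : Set X} (hE : IsCompact E)
    (c : ℕ → X → ι) (p : ι → ι)
    (hp : ∀ n x, p (c (n + 1) x) = c n x) (hfin : ∀ q, (p ⁻¹' {q}).Finite)
    (hF : ∀ n q, F (E ∩ c n ⁻¹' {q}) ≠ ∞) (q₀ : ι) (h₀ : F (E ∩ c 0 ⁻¹' {q₀}) ≠ 0) :
    ∃ μ : Measure X, IsProbabilityMeasure μ ∧ μ Eᶜ = 0 ∧
      ∀ (n : ℕ) (Q : Finset ι) (G : Set X), IsOpen G → E ∩ G ⊆ c n ⁻¹' Q →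
        μ G ≤ (F (E ∩ c 0 ⁻¹' {q₀}))⁻¹ * ∑ q ∈ Q, F (E ∩ c n ⁻¹' {q}) := by
  classical
  obtain ⟨M, hM0, hMle, hMp⟩ :=
    exists_consistent_measures_le_outerMeasure F E c p hp hfin hF q₀
  set a := F (E ∩ c 0 ⁻¹' {q₀}) with ha
  have hE0 : E.Nonempty := by
    by_contra h
    rw [Set.not_nonempty_iff_eq_empty] at h
    exact h₀ (by simp [ha, h])
  obtain ⟨e, he⟩ := hE0
  have hpm : Measurable p := measurable_of_countable _
  have hiter : ∀ n k, (M (n + k)).map p^[k] = M n := by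
    intro n k
    induction k with
    | zero => simp
    | succ k ih =>
      rw [Function.iterate_succ, ← Measure.map_map (hpm.iterate k) hpm, ← add_assoc, hMp, ih]
  have huniv : ∀ n, M n Set.univ = a := by
    intro n
    have := hiter 0 n
    rw [zero_add] at this
    have h2 := congrArg (fun m => m Set.univ) this
    rw [Measure.map_apply (hpm.iterate n) MeasurableSet.univ, Set.preimage_univ, hM0] at h2
    simpa using h2
  let pt : ℕ → ι → E := fun n q =>
    if h : (E ∩ c n ⁻¹' {q}).Nonempty then ⟨h.some, h.some_mem.1⟩ else ⟨e, he⟩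
  have hpt : ∀ n q, M n {q} ≠ 0 → c n (pt n q) = q := by
    intro n q hq
    have h : (E ∩ c n ⁻¹' {q}).Nonempty := by
      by_contra h
      rw [Set.not_nonempty_iff_eq_empty] at h
      exact hq (le_antisymm ((hMle n q).trans (by simp [h])) bot_le)
    simp only [pt, dif_pos h]
    exact h.some_mem.2
  have hciter : ∀ n k x, p^[k] (c (n + k) x) = c n x := by
    intro n k x
    induction k with
    | zero => rfl
    | succ k ih => rw [Function.iterate_succ_apply, ← add_assoc, hp, ih]
  have hae : ∀ n, ∀ᵐ q ∂(M n), c n (pt n q) = q := by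
    intro n
    rw [ae_iff_of_countable]
    exact fun q hq => hpt n q hq
  have ha_top : a ≠ ∞ := hF 0 q₀
  let ν : ℕ → ProbabilityMeasure E := fun n => ⟨a⁻¹ • (M n).map (pt n), ⟨by
    rw [Measure.smul_apply, Measure.map_apply (measurable_of_countable _) MeasurableSet.univ,
      Set.preimage_univ, huniv, smul_eq_mul, ENNReal.inv_mul_cancel h₀ ha_top]⟩⟩
  have : CompactSpace E := isCompact_iff_compactSpace.1 hE
  obtain ⟨μ, -, hμ⟩ := (isCompact_univ (X := ProbabilityMeasure E)).ultrafilter_le_nhds'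
    ((Filter.hyperfilter ℕ).map ν) Filter.univ_mem
  have hlim : Filter.Tendsto ν (Filter.hyperfilter ℕ) (nhds μ) := hμ
  refine ⟨(μ : Measure E).map Subtype.val,
    Measure.isProbabilityMeasure_map measurable_subtype_coe.aemeasurable, ?_, ?_⟩
  · rw [Measure.map_apply measurable_subtype_coe hE.measurableSet.compl]
    simp
  intro n Q G hG hGQ
  rw [Measure.map_apply measurable_subtype_coe hG.measurableSet]
  refine (ProbabilityMeasure.le_liminf_measure_open_of_tendsto hlim
    (hG.preimage continuous_subtype_val)).trans ?_
  refine Filter.liminf_le_of_frequently_le' (Filter.Eventually.frequently ?_)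
  have hev : ∀ᶠ j in (Filter.hyperfilter ℕ : Filter ℕ), n ≤ j :=
    (Nat.hyperfilter_le_atTop) (Filter.eventually_ge_atTop n)
  filter_upwards [hev] with j hj
  obtain ⟨k, rfl⟩ := Nat.exists_eq_add_of_le hj
  change (a⁻¹ • (M (n + k)).map (pt (n + k))) _ ≤ _
  rw [Measure.smul_apply, smul_eq_mul, Measure.map_apply (measurable_of_countable _)
    (measurable_subtype_coe hG.measurableSet)]
  gcongr
  calc M (n + k) (pt (n + k) ⁻¹' (Subtype.val ⁻¹' G))
      ≤ M (n + k) (p^[k] ⁻¹' Q) := by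
        refine measure_mono_ae ?_
        filter_upwards [hae (n + k)] with q hq hqG
        have h1 : c n (pt (n + k) q) ∈ Q := hGQ ⟨(pt (n + k) q).2, hqG⟩
        rw [← hciter n k, hq] at h1
        exact h1
    _ = M n Q := by
        rw [← hiter n k, Measure.map_apply (hpm.iterate k) .of_discrete]
    _ = ∑ q ∈ Q, M n {q} := (sum_measure_singleton).symm
    _ ≤ _ := Finset.sum_le_sum fun q _ => hMle n q

theorem dist_le_of_floor_eq {d : ℕ} {x y : EuclideanSpace ℝ (Fin d)} {b : ℝ} (hb : 0 < b)
    (h : ∀ i, ⌊b * x i⌋ = ⌊b * y i⌋) : dist x y ≤ √d * b⁻¹ := by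
  have hi : ∀ i, dist (x i) (y i) ≤ b⁻¹ := by
    intro i
    have h1 := Int.abs_sub_lt_one_of_floor_eq_floor (h i)
    rw [← mul_sub, abs_mul, abs_of_pos hb] at h1
    rw [Real.dist_eq, ← mul_le_mul_iff_right₀ hb, mul_inv_cancel₀ hb.ne']
    exact h1.le
  rw [EuclideanSpace.dist_eq]
  calc √(∑ i, dist (x i) (y i) ^ 2) ≤ √(∑ _i : Fin d, b⁻¹ ^ 2) := by
        gcongr with i; exact hi i
    _ = √d * b⁻¹ := by
        rw [Finset.sum_const, Finset.card_univ, Fintype.card_fin, nsmul_eq_mul,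
          Real.sqrt_mul (by positivity), Real.sqrt_sq (by positivity)]

/-- Frostman's lemma for compact subsets of Euclidean space. -/
theorem exists_frostman_measure {d : ℕ} {E : Set (EuclideanSpace ℝ (Fin d))} (hE : IsCompact E)
    {s : ℝ} (hs : 0 < s) (hH : μH[s] E ≠ 0) :
    ∃ μ : Measure (EuclideanSpace ℝ (Fin d)), IsProbabilityMeasure μ ∧ μ Eᶜ = 0 ∧
      ∃ C : ℝ, 0 < C ∧ ∀ x r, 0 < r → μ (ball x r) ≤ ENNReal.ofReal (C * r ^ s) := by
  classical
  obtain ⟨n₀, hn₀⟩ : ∃ n : ℕ, OuterMeasure.mkMetric'.pre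
      (fun A : Set (EuclideanSpace ℝ (Fin d)) => ediam A ^ s) (n : ℝ≥0∞)⁻¹ E ≠ 0 := by
    by_contra! h
    apply hH
    rw [Measure.hausdorffMeasure, ← OuterMeasure.coe_mkMetric, OuterMeasure.mkMetric,
      OuterMeasure.mkMetric'.eq_iSup_nat, OuterMeasure.iSup_apply]
    simp [h]
  set F := OuterMeasure.mkMetric'.pre
      (fun A : Set (EuclideanSpace ℝ (Fin d)) => ediam A ^ s) (n₀ : ℝ≥0∞)⁻¹
  obtain ⟨N₀, hN₀⟩ : ∃ N : ℕ, ENNReal.ofReal (√d * ((2 : ℝ) ^ N)⁻¹) ≤ (n₀ : ℝ≥0∞)⁻¹ := by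
    obtain ⟨N, hN⟩ := pow_unbounded_of_one_lt (√d * n₀) (one_lt_two (α := ℝ))
    refine ⟨N, ?_⟩
    rw [ENNReal.le_inv_iff_mul_le, ← ENNReal.ofReal_natCast, ← ENNReal.ofReal_mul (by positivity)]
    apply ENNReal.ofReal_le_one.2
    rw [mul_right_comm, ← div_eq_mul_inv, div_le_one (by positivity)]
    exact hN.le
  let c : ℕ → EuclideanSpace ℝ (Fin d) → (Fin d → ℤ) := fun n x i => ⌊(2 : ℝ) ^ (N₀ + n) * x i⌋
  let p : (Fin d → ℤ) → (Fin d → ℤ) := fun q i => q i / 2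
  have hp : ∀ n x, p (c (n + 1) x) = c n x := by
    intro n x
    funext i
    have := Int.natCast_mul_floor_div_cancel (n := 2) two_ne_zero ((2 : ℝ) ^ (N₀ + n) * x i)
    simp only [p, c]
    rw [← this]
    congr 2
    push_cast
    ring
  have hfin : ∀ q, (p ⁻¹' {q}).Finite := by
    intro q
    refine (Set.Finite.pi' fun i => Set.finite_Icc (2 * q i) (2 * q i + 1)).subset ?_
    intro q' hq' i
    have : q' i / 2 = q i := congrFun hq' i
    simp only [Set.mem_Icc]
    omega
  have hcell : ∀ n q, F (E ∩ c n ⁻¹' {q}) ≤ ENNReal.ofReal ((√d * ((2 : ℝ) ^ (N₀ + n))⁻¹) ^ s) := by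
    intro n q
    have hdiam : ediam (E ∩ c n ⁻¹' {q}) ≤ ENNReal.ofReal (√d * ((2 : ℝ) ^ (N₀ + n))⁻¹) := by
      refine ediam_le fun x hx y hy => ?_
      rw [edist_dist]
      refine ENNReal.ofReal_le_ofReal (dist_le_of_floor_eq (by positivity) fun i => ?_)
      exact congrFun ((hx.2 : c n x = q).trans (hy.2 : c n y = q).symm) i
    refine (OuterMeasure.mkMetric'.pre_le (hdiam.trans (le_trans ?_ hN₀))).trans ?_
    · gcongr
      · norm_num
      · omega
    · rw [← ENNReal.ofReal_rpow_of_nonneg (by positivity) hs.le]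
      exact ENNReal.rpow_le_rpow hdiam hs.le
  have hF : ∀ n q, F (E ∩ c n ⁻¹' {q}) ≠ ∞ := fun n q =>
    ne_top_of_le_ne_top ENNReal.ofReal_ne_top (hcell n q)
  obtain ⟨q₀, hq₀⟩ : ∃ q, F (E ∩ c 0 ⁻¹' {q}) ≠ 0 := by
    by_contra! h
    apply hn₀
    refine measure_mono_null (t := ⋃ q, E ∩ c 0 ⁻¹' {q}) ?_ (measure_iUnion_null h)
    intro x hx
    exact Set.mem_iUnion.2 ⟨c 0 x, hx, rfl⟩
  obtain ⟨μ, hμ, hμE, hμG⟩ :=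
    exists_probabilityMeasure_le_outerMeasure F hE c p hp hfin hF q₀ hq₀
  obtain ⟨A, hA0, hA⟩ : ∃ A : ℝ, 0 ≤ A ∧ (F (E ∩ c 0 ⁻¹' {q₀}))⁻¹ = ENNReal.ofReal A :=
    ⟨_, ENNReal.toReal_nonneg, (ENNReal.ofReal_toReal (ENNReal.inv_ne_top.2 hq₀)).symm⟩
  refine ⟨μ, hμ, hμE, A * (3 ^ d * (√d * 2) ^ s) + (2 ^ N₀) ^ s, by positivity, ?_⟩
  intro x r hr
  by_cases hrN : r * 2 ^ N₀ ≤ 1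
  · obtain ⟨n, hn1, hn2⟩ := exists_nat_pow_near_of_lt_one (x := r * 2 ^ N₀) (y := (1 / 2 : ℝ))
      (by positivity) hrN (by norm_num) (by norm_num)
    have h2 : (2 : ℝ) ^ (N₀ + n) * r ≤ 1 := by
      have : (2 : ℝ) ^ (N₀ + n) * r = (r * 2 ^ N₀) * 2 ^ n := by ring
      rw [this]
      calc (r * 2 ^ N₀) * 2 ^ n ≤ (1 / 2) ^ n * (2 : ℝ) ^ n := by gcongr
        _ = 1 := by rw [← mul_pow]; norm_num
    have h3 : ((2 : ℝ) ^ (N₀ + n))⁻¹ ≤ 2 * r := by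
      rw [inv_le_iff_one_le_mul₀ (by positivity)]
      have : 2 * r * (2 : ℝ) ^ (N₀ + n) = (r * 2 ^ N₀) * 2 ^ (n + 1) := by ring
      rw [this]
      calc (1 : ℝ) = (1 / 2) ^ (n + 1) * (2 : ℝ) ^ (n + 1) := by rw [← mul_pow]; norm_num
        _ ≤ _ := by gcongr
    let Q : Finset (Fin d → ℤ) := Fintype.piFinset fun i => Finset.Icc (c n x i - 1) (c n x i + 1)
    have hQ : E ∩ ball x r ⊆ c n ⁻¹' Q := by
      rintro y ⟨-, hy⟩
      simp only [Set.mem_preimage, Finset.mem_coe, Q, Fintype.mem_piFinset, Finset.mem_Icc]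
      intro i
      have h4 : |y i - x i| < r := by
        calc |y i - x i| = ‖(y - x) i‖ := by simp
          _ ≤ ‖y - x‖ := PiLp.norm_apply_le _ _
          _ < r := by rwa [mem_ball, dist_eq_norm] at hy
      rw [abs_lt] at h4
      have hb : (0 : ℝ) < 2 ^ (N₀ + n) := by positivity
      have h5 : (2 : ℝ) ^ (N₀ + n) * y i < 2 ^ (N₀ + n) * x i + 1 := by nlinarith
      have h6 : (2 : ℝ) ^ (N₀ + n) * x i < 2 ^ (N₀ + n) * y i + 1 := by nlinarith
      have h7 := Int.floor_le_floor h5.le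
      have h8 := Int.floor_le_floor h6.le
      rw [Int.floor_add_one] at h7 h8
      simp only [c]
      omega
    have hcard : Q.card = 3 ^ d := by
      simp only [Q, Fintype.card_piFinset, Int.card_Icc]
      rw [Finset.prod_congr rfl (g := fun _ => 3) fun i _ => by omega]
      simp
    refine (hμG n Q _ isOpen_ball hQ).trans ?_
    calc (F (E ∩ c 0 ⁻¹' {q₀}))⁻¹ * ∑ q ∈ Q, F (E ∩ c n ⁻¹' {q})
        ≤ ENNReal.ofReal A * ∑ q ∈ Q, ENNReal.ofReal ((√d * ((2 : ℝ) ^ (N₀ + n))⁻¹) ^ s) := by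
          rw [hA]; gcongr with q _; exact hcell n q
      _ = ENNReal.ofReal (A * (3 ^ d * (√d * ((2 : ℝ) ^ (N₀ + n))⁻¹) ^ s)) := by
          rw [Finset.sum_const, hcard, nsmul_eq_mul, ENNReal.ofReal_mul hA0,
            ENNReal.ofReal_mul (by positivity), ← ENNReal.ofReal_natCast]
          push_cast
          rfl
      _ ≤ _ := by
          apply ENNReal.ofReal_le_ofReal
          calc A * (3 ^ d * (√d * ((2 : ℝ) ^ (N₀ + n))⁻¹) ^ s)
              ≤ A * (3 ^ d * (√d * (2 * r)) ^ s) := by gcongr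
            _ = A * (3 ^ d * (√d * 2) ^ s) * r ^ s := by
                rw [← mul_assoc (√(d : ℝ)), Real.mul_rpow (by positivity) hr.le]; ring
            _ ≤ _ := by
                gcongr
                exact le_add_of_nonneg_right (by positivity)
  · push Not at hrN
    refine prob_le_one.trans ?_
    rw [← ENNReal.ofReal_one]
    apply ENNReal.ofReal_le_ofReal
    calc (1 : ℝ) ≤ (r * 2 ^ N₀) ^ s := Real.one_le_rpow hrN.le hs.le
      _ = (2 ^ N₀) ^ s * r ^ s := by rw [mul_comm, Real.mul_rpow (by positivity) hr.le]
      _ ≤ _ := by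
        gcongr
        exact le_add_of_nonneg_left (by positivity)

/-- Gaussian form of the Frostman condition with exponent `s` and constant `C`. -/
def GaussianFrostman {V : Type*} [NormedAddCommGroup V] [MeasurableSpace V] (μ : Measure V)
    (s C : ℝ) : Prop :=
  ∀ (y : V) (R : ℝ), 0 < R →
    ∫⁻ x, ENNReal.ofReal (Real.exp (-(R ^ 2 * ‖x - y‖ ^ 2))) ∂μ ≤ ENNReal.ofReal (C * R ^ (-s))

theorem exists_gaussianFrostman_of_ball_le {V : Type*} [NormedAddCommGroup V] [MeasurableSpace V]
    [BorelSpace V] {μ : Measure V} {s C : ℝ} (hC : 0 < C)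
    (h : ∀ x r, 0 < r → μ (ball x r) ≤ ENNReal.ofReal (C * r ^ s)) :
    ∃ C', 0 < C' ∧ GaussianFrostman μ s C' := by
  have hsum : Summable fun k : ℕ => Real.exp (-k) * ((k : ℝ) + 1) ^ s := by
    have h1 := (summable_nat_add_iff 1).2
      (Real.summable_pow_mul_exp_neg_nat_mul ⌈s⌉₊ zero_lt_one)
    refine Summable.of_nonneg_of_le (fun k => by positivity) (fun k => ?_)
      (h1.mul_left (Real.exp 1))
    have h2 : ((k : ℝ) + 1) ^ s ≤ ((k : ℝ) + 1) ^ ⌈s⌉₊ := by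
      rw [← Real.rpow_natCast]
      exact Real.rpow_le_rpow_of_exponent_le (by linarith [k.cast_nonneg (α := ℝ)])
        (Nat.le_ceil s)
    calc Real.exp (-k) * ((k : ℝ) + 1) ^ s ≤ Real.exp (-k) * ((k : ℝ) + 1) ^ ⌈s⌉₊ := by gcongr
      _ = Real.exp 1 * ((((k + 1 : ℕ) : ℝ)) ^ ⌈s⌉₊ * Real.exp (-1 * ((k + 1 : ℕ) : ℝ))) := by
        rw [mul_left_comm, ← Real.exp_add, mul_comm]
        push_cast
        ring_nf
  refine ⟨C * ∑' k : ℕ, Real.exp (-k) * ((k : ℝ) + 1) ^ s,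
    mul_pos hC (hsum.tsum_pos (fun k => by positivity) 0 (by positivity)), ?_⟩
  intro y R hR
  have hpt : ∀ x, ENNReal.ofReal (Real.exp (-(R ^ 2 * ‖x - y‖ ^ 2))) ≤
      ∑' k : ℕ, (ball y ((k + 1) / R)).indicator
        (fun _ => ENNReal.ofReal (Real.exp (-k))) x := by
    intro x
    set v := R ^ 2 * ‖x - y‖ ^ 2 with hv
    have hv0 : 0 ≤ v := by positivity
    refine le_trans ?_ (ENNReal.le_tsum ⌊v⌋₊)
    rw [Set.indicator_of_mem]
    · gcongr
      exact Nat.floor_le hv0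
    · rw [mem_ball, dist_eq_norm, lt_div_iff₀ hR]
      have h1 := Nat.lt_floor_add_one v
      have h2 : (1 : ℝ) ≤ (⌊v⌋₊ : ℝ) + 1 := by linarith [(⌊v⌋₊).cast_nonneg (α := ℝ)]
      refine lt_of_pow_lt_pow_left₀ 2 (by positivity) ?_
      calc (‖x - y‖ * R) ^ 2 = v := by rw [hv]; ring
        _ < _ := h1
        _ ≤ _ := le_self_pow₀ h2 two_ne_zero
  calc ∫⁻ x, ENNReal.ofReal (Real.exp (-(R ^ 2 * ‖x - y‖ ^ 2))) ∂μ
      ≤ ∫⁻ x, ∑' k : ℕ, (ball y ((k + 1) / R)).indicator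
        (fun _ => ENNReal.ofReal (Real.exp (-k))) x ∂μ := lintegral_mono hpt
    _ = ∑' k : ℕ, ENNReal.ofReal (Real.exp (-k)) * μ (ball y ((k + 1) / R)) := by
      rw [lintegral_tsum fun k => (measurable_const.indicator measurableSet_ball).aemeasurable]
      simp_rw [lintegral_indicator_const measurableSet_ball]
    _ ≤ ∑' k : ℕ, ENNReal.ofReal (C * R ^ (-s) * (Real.exp (-k) * ((k : ℝ) + 1) ^ s)) := by
      refine ENNReal.tsum_le_tsum fun k => ?_
      calc _ ≤ ENNReal.ofReal (Real.exp (-k)) * ENNReal.ofReal (C * ((k + 1) / R) ^ s) := by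
            gcongr
            exact h _ _ (by positivity)
        _ = _ := by
          rw [← ENNReal.ofReal_mul (by positivity), Real.div_rpow (by positivity) hR.le,
            Real.rpow_neg hR.le]
          congr 1
          ring
    _ = _ := by
      rw [← ENNReal.ofReal_tsum_of_nonneg (fun k => by positivity) (hsum.mul_left _), tsum_mul_left]
      congr 1
      ring

section InnerProduct

variable {V : Type*} [NormedAddCommGroup V] [InnerProductSpace ℝ V] [FiniteDimensional ℝ V]
  [MeasurableSpace V] [BorelSpace V]

theorem lintegral_exp_neg_mul_norm_sub_sq {b : ℝ} (hb : 0 < b) (x : V) :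
    ∫⁻ y : V, ENNReal.ofReal (Real.exp (-(b * ‖y - x‖ ^ 2))) =
      ENNReal.ofReal ((Real.pi / b) ^ (Module.finrank ℝ V / 2 : ℝ)) := by
  rw [lintegral_sub_right_eq_self (fun y : V => ENNReal.ofReal (Real.exp (-(b * ‖y‖ ^ 2)))) x,
    ← GaussianFourier.integral_rexp_neg_mul_sq_norm hb, ofReal_integral_eq_lintegral_ofReal]
  · simp
  · by_contra h
    have h1 := GaussianFourier.integral_rexp_neg_mul_sq_norm (V := V) hb
    rw [integral_undef h] at h1
    have : 0 < (Real.pi / b) ^ (Module.finrank ℝ V / 2 : ℝ) := by positivity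
    exact this.ne h1
  · exact Filter.Eventually.of_forall fun _ => (Real.exp_pos _).le

theorem lintegral_exp_neg_inner_sq_add_norm_sq_le (η : V) :
    ∫⁻ y : V, ENNReal.ofReal (Real.exp (-(⟪y, η⟫ ^ 2 + ‖y‖ ^ 2))) ≤
      ENNReal.ofReal (Real.pi ^ (Module.finrank ℝ V / 2 : ℝ) * (√(1 + ‖η‖ ^ 2))⁻¹) := by
  rcases eq_or_ne η 0 with rfl | hη
  · have := lintegral_exp_neg_mul_norm_sub_sq zero_lt_one (0 : V)
    simp at this
    simp [this]
  obtain ⟨n, hn⟩ : ∃ n, Module.finrank ℝ V = n + 1 := by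
    have : Nontrivial V := ⟨η, 0, hη⟩
    exact Nat.exists_eq_succ_of_ne_zero (Module.finrank_pos (R := ℝ) (M := V)).ne'
  have hη' : ‖η‖ ≠ 0 := norm_ne_zero_iff.2 hη
  obtain ⟨b, hb⟩ := Orthonormal.exists_orthonormalBasis_extension_of_card_eq (𝕜 := ℝ) (E := V)
    (ι := Fin (n + 1)) (by simp [hn]) (v := fun _ => ‖η‖⁻¹ • η) (s := {0}) (by
      rw [orthonormal_iff_ite]
      rintro ⟨i, rfl⟩ ⟨j, rfl⟩
      simp [norm_smul, hη'])
  have hb0 : b 0 = ‖η‖⁻¹ • η := hb 0 rfl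
  have hη0 : η = ‖η‖ • b 0 := by rw [hb0, smul_smul, mul_inv_cancel₀ hη', one_smul]
  rw [← (b.measurePreserving_repr_symm.comp (PiLp.volume_preserving_toLp _)).lintegral_comp
    (by fun_prop)]
  let w : Fin (n + 1) → ℝ := Fin.cons (1 + ‖η‖ ^ 2) fun _ => 1
  have hw : ∀ i, 0 < w i := by
    intro i
    refine Fin.cases ?_ (fun i => ?_) i
    · simp only [w, Fin.cons_zero]; positivity
    · simp [w]
  have hfun : ∀ z : Fin (n + 1) → ℝ,
      Real.exp (-(⟪b.repr.symm (WithLp.toLp 2 z), η⟫ ^ 2 + ‖b.repr.symm (WithLp.toLp 2 z)‖ ^ 2)) =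
        ∏ i, Real.exp (-w i * z i ^ 2) := by
    intro z
    rw [← Real.exp_sum, LinearIsometryEquiv.norm_map, EuclideanSpace.norm_sq_eq]
    congr 1
    have : ⟪b.repr.symm (WithLp.toLp 2 z), η⟫ = ‖η‖ * z 0 := by
      conv_lhs => rw [hη0]
      rw [inner_smul_right, real_inner_comm, ← b.repr_apply_apply]
      simp
    rw [this, Fin.sum_univ_succ, Fin.sum_univ_succ]
    simp [w]
    ring
  simp only [Function.comp_apply, hfun]
  rw [← ofReal_integral_eq_lintegral_ofReal]
  · rw [integral_fintype_prod_volume_eq_prod (fun i (t : ℝ) => Real.exp (-w i * t ^ 2))]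
    refine le_of_eq (congrArg _ ?_)
    simp_rw [integral_gaussian]
    rw [Fin.prod_univ_succ]
    simp only [w, Fin.cons_zero, Fin.cons_succ, div_one, Finset.prod_const, Finset.card_univ,
      Fintype.card_fin]
    rw [hn, Real.sqrt_div' _ (by positivity), Real.sqrt_eq_rpow, Real.sqrt_eq_rpow,
      ← Real.rpow_natCast _ n, ← Real.rpow_mul Real.pi_pos.le, div_eq_mul_inv, mul_right_comm,
      ← Real.rpow_add Real.pi_pos]
    push_cast
    ring_nf
  · exact Integrable.fintype_prod (f := fun i (t : ℝ) => Real.exp (-w i * t ^ 2))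
      fun i => integrable_exp_neg_mul_sq (hw i)
  · exact Filter.Eventually.of_forall fun _ => Finset.prod_nonneg fun _ _ => (Real.exp_pos _).le

/-- Gaussian form of the bound for the mass of a slab of width `1 / ‖η‖`. -/
theorem GaussianFrostman.lintegral_slab_le {μ : Measure V} [SFinite μ] {s C : ℝ} (hC : 0 < C)
    (h : GaussianFrostman μ s C) : ∃ C', 0 < C' ∧ ∀ η : V,
      ∫⁻ x, ENNReal.ofReal (Real.exp (-(2 * (⟪x, η⟫ ^ 2 + ‖x‖ ^ 2)))) ∂μ ≤
        ENNReal.ofReal (C' * √(1 + ‖η‖ ^ 2) ^ (Module.finrank ℝ V - 1 - s : ℝ)) := by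
  set D : ℝ := (Module.finrank ℝ V : ℝ)
  refine ⟨C * √2 ^ (-s) * 2 ^ D, by positivity, fun η => ?_⟩
  set R := √(1 + ‖η‖ ^ 2) with hR
  have hR2 : R ^ 2 = 1 + ‖η‖ ^ 2 := Real.sq_sqrt (by positivity)
  have hR0 : 0 < R := Real.sqrt_pos.2 (by positivity)
  let Q : V → ℝ := fun x => ⟪x, η⟫ ^ 2 + ‖x‖ ^ 2
  have hQ : ∀ x y, Q y + 2 * R ^ 2 * ‖y - x‖ ^ 2 ≤ 2 * Q x + 4 * R ^ 2 * ‖y - x‖ ^ 2 := by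
    intro x y
    have h1 : ⟪y, η⟫ = ⟪x, η⟫ + ⟪y - x, η⟫ := by rw [← inner_add_left]; simp
    have h2 : ‖y‖ ≤ ‖x‖ + ‖y - x‖ := by simpa using norm_add_le x (y - x)
    have h3 : ⟪y - x, η⟫ ^ 2 ≤ ‖y - x‖ ^ 2 * ‖η‖ ^ 2 := by
      rw [← mul_pow, ← sq_abs]
      gcongr
      exact abs_real_inner_le_norm _ _
    have h4 : ‖y‖ ^ 2 ≤ (‖x‖ + ‖y - x‖) ^ 2 := by gcongr
    simp only [Q]
    rw [h1, hR2]
    nlinarith [sq_nonneg (⟪x, η⟫ - ⟪y - x, η⟫), sq_nonneg (‖x‖ - ‖y - x‖)]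
  have hmeas : Measurable fun z : V × V => ENNReal.ofReal (Real.exp (-(Q z.2))) *
      ENNReal.ofReal (Real.exp (-((√2 * R) ^ 2 * ‖z.1 - z.2‖ ^ 2))) := by
    simp only [Q]
    fun_prop
  have key : ENNReal.ofReal ((Real.pi / (4 * R ^ 2)) ^ (D / 2)) *
      ∫⁻ x, ENNReal.ofReal (Real.exp (-(2 * Q x))) ∂μ ≤
      ENNReal.ofReal (C * (√2 * R) ^ (-s)) * ENNReal.ofReal (Real.pi ^ (D / 2) * R⁻¹) := by
    calc _ = ∫⁻ x, (∫⁻ y : V, ENNReal.ofReal (Real.exp (-(2 * Q x))) *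
          ENNReal.ofReal (Real.exp (-(4 * R ^ 2 * ‖y - x‖ ^ 2)))) ∂μ := by
          rw [mul_comm, ← lintegral_mul_const' _ _ ENNReal.ofReal_ne_top]
          refine lintegral_congr fun x => ?_
          rw [lintegral_const_mul' _ _ ENNReal.ofReal_ne_top,
            lintegral_exp_neg_mul_norm_sub_sq (by positivity)]
      _ ≤ ∫⁻ x, (∫⁻ y : V, ENNReal.ofReal (Real.exp (-(Q y))) *
          ENNReal.ofReal (Real.exp (-((√2 * R) ^ 2 * ‖x - y‖ ^ 2)))) ∂μ := by
          refine lintegral_mono fun x => lintegral_mono fun y => ?_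
          simp only
          rw [← ENNReal.ofReal_mul (Real.exp_pos _).le, ← ENNReal.ofReal_mul (Real.exp_pos _).le,
            ← Real.exp_add, ← Real.exp_add, mul_pow, Real.sq_sqrt zero_le_two, norm_sub_rev x y]
          exact ENNReal.ofReal_le_ofReal (Real.exp_le_exp.2 (by linarith [hQ x y]))
      _ = ∫⁻ y : V, ∫⁻ x, ENNReal.ofReal (Real.exp (-(Q y))) *
          ENNReal.ofReal (Real.exp (-((√2 * R) ^ 2 * ‖x - y‖ ^ 2))) ∂μ :=
          lintegral_lintegral_swap hmeas.aemeasurable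
      _ ≤ ∫⁻ y : V, ENNReal.ofReal (Real.exp (-(Q y))) * ENNReal.ofReal (C * (√2 * R) ^ (-s)) := by
          refine lintegral_mono fun y => ?_
          rw [lintegral_const_mul' _ _ ENNReal.ofReal_ne_top]
          gcongr
          exact h y _ (by positivity)
      _ ≤ _ := by
          rw [lintegral_mul_const' _ _ ENNReal.ofReal_ne_top, mul_comm]
          gcongr
          exact lintegral_exp_neg_inner_sq_add_norm_sq_le η
  have hc0 : 0 < (Real.pi / (4 * R ^ 2)) ^ (D / 2) := by positivity
  rw [mul_comm, ← ENNReal.le_div_iff_mul_le (Or.inl (by simpa using hc0))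
    (Or.inl ENNReal.ofReal_ne_top), ← ENNReal.ofReal_mul (by positivity),
    ← ENNReal.ofReal_div_of_pos hc0] at key
  refine key.trans (le_of_eq (congrArg _ ?_))
  have e1 : (4 * R ^ 2) ^ (D / 2) = 2 ^ D * R ^ D := by
    rw [show 4 * R ^ 2 = (2 * R) ^ 2 by ring, ← Real.rpow_natCast, ← Real.rpow_mul (by positivity),
      ← Real.mul_rpow zero_le_two hR0.le]
    congr 1
    push_cast
    ring
  have e2 : R ^ (D - 1 - s) = R ^ D * R⁻¹ * R ^ (-s) := by
    rw [← Real.rpow_neg_one, ← Real.rpow_add hR0, ← Real.rpow_add hR0]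
    ring_nf
  rw [Real.div_rpow Real.pi_pos.le (by positivity), e1, e2, Real.mul_rpow (by positivity) hR0.le]
  have : Real.pi ^ (D / 2) ≠ 0 := by positivity
  field_simp

theorem integrable_exp_neg_mul_norm_sq {b : ℝ} (hb : 0 < b) :
    Integrable fun v : V => Real.exp (-(b * ‖v‖ ^ 2)) := by
  refine ⟨by fun_prop, ?_⟩
  rw [hasFiniteIntegral_iff_ofReal (Filter.Eventually.of_forall fun _ => (Real.exp_pos _).le)]
  have := lintegral_exp_neg_mul_norm_sub_sq hb (0 : V)
  simp only [sub_zero] at this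
  rw [this]
  exact ENNReal.ofReal_lt_top

theorem integral_charFun_add_mul_gaussian (μ : Measure V) [IsFiniteMeasure μ] {u : ℝ} (hu : 0 < u)
    (ξ : V) :
    ∫ ζ : V, charFun μ (ξ + ζ) * (Real.exp (-(u * ‖ζ‖ ^ 2)) : ℂ) =
      ((Real.pi / u) ^ (Module.finrank ℝ V / 2 : ℝ) : ℝ) *
        ∫ x, Complex.exp (⟪x, ξ⟫ * Complex.I) * (Real.exp (-(‖x‖ ^ 2 / (4 * u))) : ℂ) ∂μ := by
  simp_rw [charFun_apply, ← integral_mul_const]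
  rw [integral_integral_swap, ← integral_const_mul]
  · refine integral_congr_ae (Filter.Eventually.of_forall fun x => ?_)
    have h1 : ∀ ζ : V, Complex.exp (⟪x, ξ + ζ⟫ * Complex.I) * (Real.exp (-(u * ‖ζ‖ ^ 2)) : ℂ) =
        Complex.exp (⟪x, ξ⟫ * Complex.I) *
          Complex.exp (-u * ‖ζ‖ ^ 2 + Complex.I * ⟪x, ζ⟫) := by
      intro ζ
      rw [inner_add_right, Complex.ofReal_exp, ← Complex.exp_add, ← Complex.exp_add]
      push_cast
      ring_nf
    simp only [h1]
    rw [integral_const_mul, GaussianFourier.integral_cexp_neg_mul_sq_norm_add (by simpa using hu),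
      mul_left_comm]
    congr 1
    · rw [Complex.ofReal_cpow (by positivity)]
      push_cast
      rfl
    · congr 1
      push_cast
      congr 1
      rw [Complex.I_sq]
      ring
  · have h2 : Integrable (fun p : V × V => Real.exp (-(u * ‖p.1‖ ^ 2))) (volume.prod μ) :=
      (integrable_exp_neg_mul_norm_sq hu).comp_fst μ
    refine h2.mono' (by fun_prop) (Filter.Eventually.of_forall fun p => ?_)
    simp only [Function.uncurry, norm_mul, Complex.norm_exp_ofReal_mul_I, one_mul,
      Complex.norm_real, Real.norm_eq_abs, Real.abs_exp, le_refl]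

theorem GaussianFrostman.lintegral_charFun_sq_mul_gaussian_le {μ : Measure V}
    [IsProbabilityMeasure μ] {s C : ℝ} (hC : 0 < C) (h : GaussianFrostman μ s C) :
    ∃ C', 0 < C' ∧ ∀ u, 0 < u →
      ∫⁻ η : V, ENNReal.ofReal (Real.exp (-(u * ‖η‖ ^ 2))) * ‖charFun μ η‖ₑ ^ 2 ≤
        ENNReal.ofReal (C' * u ^ (-((Module.finrank ℝ V - s) / 2))) := by
  set D : ℝ := (Module.finrank ℝ V : ℝ)
  refine ⟨Real.pi ^ (D / 2) * (C * 2 ^ s), by positivity, fun u hu => ?_⟩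
  have hneg : Measurable fun x : V => -x := by fun_prop
  have : IsProbabilityMeasure (μ.map fun x : V => -x) :=
    Measure.isProbabilityMeasure_map hneg.aemeasurable
  set ρ : Measure V := μ ∗ (μ.map fun x : V => -x) with hρ
  have hchar : ∀ η, charFun ρ η = ((‖charFun μ η‖ ^ 2 : ℝ) : ℂ) := by
    intro η
    have : charFun (μ.map fun x : V => -x) η = (starRingEnd ℂ) (charFun μ η) := by
      rw [← charFun_neg, charFun_apply, charFun_apply, integral_map (by fun_prop) (by fun_prop)]
      simp
    rw [hρ, charFun_conv, this, Complex.mul_conj, Complex.normSq_eq_norm_sq]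
  have hkey := integral_charFun_add_mul_gaussian ρ hu (0 : V)
  simp only [zero_add, inner_zero_right, Complex.ofReal_zero, zero_mul, Complex.exp_zero, one_mul,
    hchar, ← Complex.ofReal_mul, integral_complex_ofReal] at hkey
  have hkey := Complex.ofReal_injective hkey
  have hlint : ∫⁻ η : V, ENNReal.ofReal (Real.exp (-(u * ‖η‖ ^ 2))) * ‖charFun μ η‖ₑ ^ 2 =
      ENNReal.ofReal (∫ η : V, ‖charFun μ η‖ ^ 2 * Real.exp (-(u * ‖η‖ ^ 2))) := by
    rw [ofReal_integral_eq_lintegral_ofReal]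
    · refine lintegral_congr fun η => ?_
      rw [mul_comm, ENNReal.ofReal_mul (by positivity), ENNReal.ofReal_pow (norm_nonneg _),
        ofReal_norm]
    · refine (integrable_exp_neg_mul_norm_sq hu).mono'
        ((measurable_charFun.norm.pow_const 2).mul (by fun_prop)).aestronglyMeasurable
        (Filter.Eventually.of_forall fun η => ?_)
      rw [norm_mul, Real.norm_eq_abs, Real.norm_eq_abs, Real.abs_exp, abs_of_nonneg (by positivity)]
      refine mul_le_of_le_one_left (Real.exp_pos _).le ?_
      exact pow_le_one₀ (norm_nonneg _) (norm_charFun_le_one η)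
    · exact Filter.Eventually.of_forall fun η => by positivity
  rw [hlint, hkey, ENNReal.ofReal_mul (by positivity)]
  have hbound : ENNReal.ofReal (∫ x, Real.exp (-(‖x‖ ^ 2 / (4 * u))) ∂ρ) ≤
      ENNReal.ofReal (C * (1 / (2 * √u)) ^ (-s)) := by
    rw [ofReal_integral_eq_lintegral_ofReal]
    · rw [hρ, Measure.lintegral_conv (by fun_prop)]
      have : ∀ x : V, ∫⁻ y, ENNReal.ofReal (Real.exp (-(‖x + y‖ ^ 2 / (4 * u))))
          ∂(μ.map fun x : V => -x) ≤ ENNReal.ofReal (C * (1 / (2 * √u)) ^ (-s)) := by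
        intro x
        rw [lintegral_map (by fun_prop) hneg]
        refine le_trans (le_of_eq (lintegral_congr fun y => ?_))
          (h x (1 / (2 * √u)) (by positivity))
        congr 3
        rw [div_pow, mul_pow, Real.sq_sqrt hu.le, ← sub_eq_add_neg, norm_sub_rev]
        ring
      refine (lintegral_mono this).trans ?_
      simp
    · refine (integrable_const (1 : ℝ)).mono' (by fun_prop) (Filter.Eventually.of_forall fun x => ?_)
      rw [Real.norm_eq_abs, Real.abs_exp, Real.exp_le_one_iff, neg_nonpos]
      positivity
    · exact Filter.Eventually.of_forall fun η => by positivity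
  refine (mul_le_mul_right hbound _).trans (le_of_eq ?_)
  rw [← ENNReal.ofReal_mul (by positivity)]
  congr 1
  rw [Real.div_rpow Real.pi_pos.le hu.le, one_div, Real.inv_rpow (by positivity),
    Real.rpow_neg (by positivity), inv_inv, Real.mul_rpow (by positivity) (by positivity),
    Real.sqrt_eq_rpow, ← Real.rpow_mul hu.le,
    show -((D - s) / 2) = 1 / 2 * s - D / 2 by ring, Real.rpow_sub hu]
  ring

theorem lintegral_rpow_mul_exp_neg_mul_Ioi {p q : ℝ} (hp : 0 < p) (hq : 0 < q) :
    ∫⁻ u in Set.Ioi (0 : ℝ), ENNReal.ofReal (u ^ (p - 1) * Real.exp (-(q * u))) =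
      ENNReal.ofReal (q ^ (-p) * Real.Gamma p) := by
  have h := Real.integral_rpow_mul_exp_neg_mul_Ioi hp hq
  have hpos : 0 < (1 / q) ^ p * Real.Gamma p :=
    mul_pos (by positivity) (Real.Gamma_pos_of_pos hp)
  rw [Real.rpow_neg hq.le, ← Real.inv_rpow hq.le, ← one_div, ← h,
    ofReal_integral_eq_lintegral_ofReal]
  · by_contra hn
    rw [integral_undef hn] at h
    exact hpos.ne h
  · refine (ae_restrict_iff' measurableSet_Ioi).2 (Filter.Eventually.of_forall fun u hu => ?_)
    have : (0 : ℝ) < u := hu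
    positivity

theorem GaussianFrostman.lintegral_charFun_sq_mul_rpow_lt_top {μ : Measure V}
    [IsProbabilityMeasure μ] {s C p : ℝ} (hC : 0 < C) (h : GaussianFrostman μ s C) (hp : 0 < p)
    (hps : (Module.finrank ℝ V - s) / 2 < p) :
    ∫⁻ η : V, ENNReal.ofReal ((1 + ‖η‖ ^ 2) ^ (-p)) * ‖charFun μ η‖ₑ ^ 2 < ∞ := by
  obtain ⟨C', hC', hE⟩ := h.lintegral_charFun_sq_mul_gaussian_le hC
  set q : ℝ := (Module.finrank ℝ V - s) / 2
  have hΓ := Real.Gamma_pos_of_pos hp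
  have hpt : ∀ η : V, ENNReal.ofReal ((1 + ‖η‖ ^ 2) ^ (-p)) =
      ENNReal.ofReal (Real.Gamma p)⁻¹ * ∫⁻ u in Set.Ioi (0 : ℝ),
        ENNReal.ofReal (u ^ (p - 1) * Real.exp (-((1 + ‖η‖ ^ 2) * u))) := by
    intro η
    rw [lintegral_rpow_mul_exp_neg_mul_Ioi hp (by positivity),
      ← ENNReal.ofReal_mul (by positivity)]
    congr 1
    field_simp
  simp_rw [hpt, mul_assoc]
  rw [lintegral_const_mul' _ _ ENNReal.ofReal_ne_top]
  refine ENNReal.mul_lt_top ENNReal.ofReal_lt_top ?_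
  have hch : Measurable fun η : V => ‖charFun μ η‖ₑ ^ 2 := measurable_charFun.enorm.pow_const 2
  have hswap : ∫⁻ η : V, (∫⁻ u in Set.Ioi (0 : ℝ),
        ENNReal.ofReal (u ^ (p - 1) * Real.exp (-((1 + ‖η‖ ^ 2) * u)))) * ‖charFun μ η‖ₑ ^ 2 =
      ∫⁻ u in Set.Ioi (0 : ℝ), (∫⁻ η : V,
        ENNReal.ofReal (u ^ (p - 1) * Real.exp (-((1 + ‖η‖ ^ 2) * u))) * ‖charFun μ η‖ₑ ^ 2) := by
    rw [← lintegral_lintegral_swap]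
    · refine lintegral_congr fun η => ?_
      rw [lintegral_mul_const _ (by fun_prop)]
    · refine Measurable.aemeasurable (Measurable.mul ?_ (hch.comp measurable_fst))
      fun_prop
  rw [hswap]
  calc _ ≤ ∫⁻ u in Set.Ioi (0 : ℝ),
        ENNReal.ofReal C' * ENNReal.ofReal (u ^ (p - q - 1) * Real.exp (-(1 * u))) := by
        refine setLIntegral_mono' measurableSet_Ioi fun u hu => ?_
        have hu : (0 : ℝ) < u := hu
        calc _ = ENNReal.ofReal (u ^ (p - 1) * Real.exp (-u)) * ∫⁻ η : V,
              ENNReal.ofReal (Real.exp (-(u * ‖η‖ ^ 2))) * ‖charFun μ η‖ₑ ^ 2 := by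
              rw [← lintegral_const_mul' _ _ ENNReal.ofReal_ne_top]
              refine lintegral_congr fun η => ?_
              rw [← mul_assoc, ← ENNReal.ofReal_mul (by positivity), mul_assoc, ← Real.exp_add]
              ring_nf
          _ ≤ ENNReal.ofReal (u ^ (p - 1) * Real.exp (-u)) * ENNReal.ofReal (C' * u ^ (-q)) := by
              gcongr
              exact hE u hu
          _ = _ := by
              rw [← ENNReal.ofReal_mul (by positivity), ← ENNReal.ofReal_mul (by positivity),
                show p - q - 1 = (p - 1) + -q by ring, Real.rpow_add hu]
              ring_nf
    _ < ∞ := by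
        rw [lintegral_const_mul' _ _ ENNReal.ofReal_ne_top,
          lintegral_rpow_mul_exp_neg_mul_Ioi (by linarith) one_pos]
        exact ENNReal.mul_lt_top ENNReal.ofReal_lt_top ENNReal.ofReal_lt_top

/-- The Gaussian-weighted mass of a slab of width about `1 / ‖η‖`. -/
theorem GaussianFrostman.lintegral_exp_neg_inner_sq_le {μ : Measure V} [SFinite μ] {s C κ ρ : ℝ}
    (hC : 0 < C) (h : GaussianFrostman μ s C) (hκ : 0 < κ) (hκ2 : κ ≤ 2)
    (hs : Module.finrank ℝ V - 1 ≤ s) (hρ : ∀ᵐ x ∂μ, ‖x‖ ≤ ρ) :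
    ∃ C', 0 < C' ∧ ∀ η : V, ∫⁻ x, ENNReal.ofReal (Real.exp (-(κ * ⟪x, η⟫ ^ 2))) ∂μ ≤
      ENNReal.ofReal (C' * √(1 + ‖η‖ ^ 2) ^ (Module.finrank ℝ V - 1 - s : ℝ)) := by
  obtain ⟨C', hC', hslab⟩ := h.lintegral_slab_le hC
  set e : ℝ := Module.finrank ℝ V - 1 - s with he
  refine ⟨Real.exp (2 * ρ ^ 2) * (C' * √(κ / 2) ^ e), by positivity, fun η => ?_⟩
  calc _ ≤ ∫⁻ x, ENNReal.ofReal (Real.exp (2 * ρ ^ 2)) * ENNReal.ofReal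
        (Real.exp (-(2 * (⟪x, √(κ / 2) • η⟫ ^ 2 + ‖x‖ ^ 2)))) ∂μ := by
        refine lintegral_mono_ae ?_
        filter_upwards [hρ] with x hx
        rw [← ENNReal.ofReal_mul (by positivity), ← Real.exp_add]
        gcongr
        rw [inner_smul_right, mul_pow, Real.sq_sqrt (by positivity)]
        have : ‖x‖ ^ 2 ≤ ρ ^ 2 := by gcongr
        linarith
    _ ≤ ENNReal.ofReal (Real.exp (2 * ρ ^ 2)) *
        ENNReal.ofReal (C' * √(1 + ‖√(κ / 2) • η‖ ^ 2) ^ e) := by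
        rw [lintegral_const_mul' _ _ ENNReal.ofReal_ne_top]
        gcongr
        exact hslab _
    _ ≤ _ := by
        rw [← ENNReal.ofReal_mul (by positivity), mul_assoc, mul_assoc,
          ← Real.mul_rpow (by positivity) (by positivity), ← Real.sqrt_mul (by positivity)]
        refine ENNReal.ofReal_le_ofReal ?_
        gcongr ?_ * (?_ * ?_)
        refine Real.rpow_le_rpow_of_nonpos (by positivity) ?_ (by linarith)
        refine Real.sqrt_le_sqrt ?_
        rw [norm_smul, mul_pow, Real.norm_of_nonneg (by positivity), Real.sq_sqrt (by positivity)]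
        linarith

theorem sq_lintegral_mul_le {α : Type*} [MeasurableSpace α] {μ : Measure α} {f g : α → ℝ≥0∞}
    (hf : AEMeasurable f μ) (hg : AEMeasurable g μ) :
    (∫⁻ a, f a * g a ∂μ) ^ 2 ≤ (∫⁻ a, f a ^ 2 ∂μ) * ∫⁻ a, g a ^ 2 ∂μ := by
  have h := ENNReal.lintegral_mul_le_Lp_mul_Lq μ Real.HolderConjugate.two_two hf hg
  have h2 : ∀ x : ℝ≥0∞, (x ^ (1 / 2 : ℝ)) ^ 2 = x := fun x => by
    rw [← ENNReal.rpow_natCast, ← ENNReal.rpow_mul]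
    norm_num
  simp only [Pi.mul_apply, ENNReal.rpow_two] at h
  calc _ ≤ _ := pow_le_pow_left₀ (zero_le) h 2
    _ = _ := by rw [mul_pow, h2, h2]

/-- The measure with density `exp (-‖x‖ ^ 2 / 2)` with respect to `μ`. -/
def gaussianWeight {V : Type*} [NormedAddCommGroup V] [MeasurableSpace V] (μ : Measure V) : Measure V :=
  μ.withDensity fun x => ENNReal.ofReal (Real.exp (-(‖x‖ ^ 2 / 2)))

instance (μ : Measure V) [IsFiniteMeasure μ] : IsFiniteMeasure (gaussianWeight μ) := by
  refine isFiniteMeasure_withDensity ?_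
  refine ne_top_of_le_ne_top (measure_ne_top μ Set.univ) ?_
  rw [← lintegral_one]
  refine lintegral_mono fun x => ?_
  simp only [ENNReal.ofReal_le_one, Real.exp_le_one_iff, neg_nonpos]
  positivity

theorem absolutelyContinuous_gaussianWeight {V : Type*} [NormedAddCommGroup V] [MeasurableSpace V]
    [BorelSpace V] (μ : Measure V) : μ ≪ gaussianWeight μ :=
  withDensity_absolutelyContinuous' (by fun_prop)
    (Filter.Eventually.of_forall fun x => by simp [Real.exp_pos])

theorem charFun_gaussianWeight {V : Type*} [NormedAddCommGroup V] [InnerProductSpace ℝ V]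
    [MeasurableSpace V] [BorelSpace V] (μ : Measure V) (ξ : V) : charFun (gaussianWeight μ) ξ =
    ∫ x, Complex.exp (⟪x, ξ⟫ * Complex.I) * (Real.exp (-(‖x‖ ^ 2 / 2)) : ℂ) ∂μ := by
  rw [charFun_apply, gaussianWeight, integral_withDensity_eq_integral_toReal_smul (by fun_prop)
    (by simp)]
  refine integral_congr_ae (Filter.Eventually.of_forall fun x => ?_)
  simp only [ENNReal.toReal_ofReal (Real.exp_pos _).le, Complex.real_smul]
  ring

theorem exists_sq_charFun_gaussianWeight_le (μ : Measure V) [IsFiniteMeasure μ] :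
    ∃ K : ℝ≥0∞, K ≠ ∞ ∧ ∀ ξ : V, ‖charFun (gaussianWeight μ) ξ‖ₑ ^ 2 ≤
      K * ∫⁻ η : V, ENNReal.ofReal (Real.exp (-(1 / 2 * ‖η - ξ‖ ^ 2))) * ‖charFun μ η‖ₑ ^ 2 := by
  set c : ℝ := (Real.pi / (1 / 2)) ^ (Module.finrank ℝ V / 2 : ℝ) with hc
  have hcpos : 0 < c := by positivity
  refine ⟨ENNReal.ofReal c⁻¹ ^ 2 * ENNReal.ofReal c,
    ENNReal.mul_ne_top (by simp) ENNReal.ofReal_ne_top, fun ξ => ?_⟩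
  have h := integral_charFun_add_mul_gaussian μ (u := 1 / 2) (by norm_num) ξ
  rw [show (4 : ℝ) * (1 / 2) = 2 by norm_num, ← charFun_gaussianWeight] at h
  replace h : charFun (gaussianWeight μ) ξ =
      (c⁻¹ : ℝ) * ∫ ζ : V, charFun μ (ξ + ζ) * (Real.exp (-(1 / 2 * ‖ζ‖ ^ 2)) : ℂ) := by
    rw [h, ← mul_assoc, ← Complex.ofReal_mul, inv_mul_cancel₀ hcpos.ne', Complex.ofReal_one,
      one_mul]
  have hch : Measurable (charFun μ) := measurable_charFun
  have h2 : ‖∫ ζ : V, charFun μ (ξ + ζ) * (Real.exp (-(1 / 2 * ‖ζ‖ ^ 2)) : ℂ)‖ₑ ^ 2 ≤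
      ENNReal.ofReal c *
       ∫⁻ ζ : V, ENNReal.ofReal (Real.exp (-(1 / 2 * ‖ζ‖ ^ 2))) * ‖charFun μ (ζ + ξ)‖ₑ ^ 2 := by
    have hsq : ∀ ζ : V, ENNReal.ofReal (Real.exp (-(1 / 4 * ‖ζ‖ ^ 2))) ^ 2 =
        ENNReal.ofReal (Real.exp (-(1 / 2 * ‖ζ‖ ^ 2))) := by
      intro ζ
      rw [← ENNReal.ofReal_pow (by positivity), ← Real.exp_nat_mul]
      congr 2
      push_cast
      ring
    calc _ ≤ (∫⁻ ζ : V, ENNReal.ofReal (Real.exp (-(1 / 4 * ‖ζ‖ ^ 2))) *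
          (ENNReal.ofReal (Real.exp (-(1 / 4 * ‖ζ‖ ^ 2))) * ‖charFun μ (ζ + ξ)‖ₑ)) ^ 2 := by
          gcongr
          refine (enorm_integral_le_lintegral_enorm _).trans
            (le_of_eq (lintegral_congr fun ζ => ?_))
          rw [← mul_assoc, ← sq, hsq, enorm_mul, mul_comm, add_comm,
            ← ofReal_norm (Complex.ofReal _), Complex.norm_real,
            Real.norm_of_nonneg (by positivity)]
      _ ≤ _ := sq_lintegral_mul_le (by fun_prop) (by fun_prop)
      _ = _ := by
          simp only [mul_pow, hsq]
          congr 1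
          have h0 := lintegral_exp_neg_mul_norm_sub_sq (V := V) (b := 1 / 2) (by norm_num) 0
          simpa only [sub_zero] using h0
  rw [h, enorm_mul, mul_pow, mul_assoc]
  gcongr
  · rw [← ofReal_norm, Complex.norm_real, Real.norm_of_nonneg (by positivity)]
  · refine h2.trans (le_of_eq ?_)
    rw [← lintegral_sub_right_eq_self _ ξ]
    simp

theorem exists_lintegral_exp_neg_norm_sub_smul_sq_le {V : Type*} [NormedAddCommGroup V]
    [InnerProductSpace ℝ V] {n : V} (hn : n ≠ 0) : ∃ L : ℝ≥0∞, L ≠ ∞ ∧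
    ∀ η : V, ∫⁻ t : ℝ, ENNReal.ofReal (Real.exp (-(1 / 4 * ‖η - t • n‖ ^ 2))) ≤ L := by
  have hn' : 0 < ‖n‖ ^ 2 := by positivity
  have hb : 0 < 1 / 4 * ‖n‖ ^ 2 := by positivity
  refine ⟨_, ENNReal.ofReal_ne_top, fun η => le_trans (lintegral_mono fun t => ?_)
    (lintegral_exp_neg_mul_norm_sub_sq hb (⟪η, n⟫ / ‖n‖ ^ 2)).le⟩
  rw [mul_assoc]
  gcongr ENNReal.ofReal (Real.exp (-(1 / 4 * ?_)))
  have hcs : ⟪η, n⟫ ^ 2 ≤ ‖η‖ ^ 2 * ‖n‖ ^ 2 := by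
    rw [← mul_pow, sq_le_sq, abs_of_nonneg (by positivity : (0 : ℝ) ≤ ‖η‖ * ‖n‖)]
    exact abs_real_inner_le_norm η n
  rw [norm_sub_sq_real η, norm_smul, mul_pow, inner_smul_right, Real.norm_eq_abs, Real.norm_eq_abs,
    sq_abs, sq_abs]
  field_simp
  nlinarith

theorem exp_neg_norm_sub_smul_sq_le {V : Type*} [NormedAddCommGroup V] [InnerProductSpace ℝ V]
    {m : ℕ} {κ ρ : ℝ} (hκ0 : 0 ≤ κ) (hκ : κ * (m * ρ ^ 2) ≤ 1 / 4)
    {x : Fin m → V} (hx : ∀ i, ‖x i‖ ≤ ρ) {n : V} (hn : ∀ i, ⟪n, x i⟫ = 0) (η : V) (t : ℝ) :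
    Real.exp (-(1 / 2 * ‖η - t • n‖ ^ 2)) ≤
      Real.exp (-(1 / 4 * ‖η - t • n‖ ^ 2)) * ∏ i, Real.exp (-(κ * ⟪x i, η⟫ ^ 2)) := by
  rw [← Real.exp_sum, ← Real.exp_add]
  gcongr
  have h1 : ∀ i, κ * ⟪x i, η⟫ ^ 2 ≤ κ * (ρ ^ 2 * ‖η - t • n‖ ^ 2) := by
    intro i
    have h2 : ⟪x i, η⟫ = ⟪x i, η - t • n⟫ := by
      rw [inner_sub_right, inner_smul_right, real_inner_comm n, hn i]
      ring
    have h3 : ⟪x i, η⟫ ^ 2 ≤ (‖x i‖ * ‖η - t • n‖) ^ 2 := by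
      rw [h2, sq_le_sq, abs_of_nonneg (by positivity : (0 : ℝ) ≤ ‖x i‖ * ‖η - t • n‖)]
      exact abs_real_inner_le_norm _ _
    gcongr
    refine h3.trans ?_
    rw [mul_pow]
    gcongr
    exact hx i
  have h4 : ∑ i, κ * ⟪x i, η⟫ ^ 2 ≤ 1 / 4 * ‖η - t • n‖ ^ 2 := by
    calc _ ≤ ∑ _i : Fin m, κ * (ρ ^ 2 * ‖η - t • n‖ ^ 2) := Finset.sum_le_sum fun i _ => h1 i
      _ = κ * (m * ρ ^ 2) * ‖η - t • n‖ ^ 2 := by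
        rw [Finset.sum_const, Finset.card_univ, Fintype.card_fin, nsmul_eq_mul]
        ring
      _ ≤ _ := by gcongr
  rw [Finset.sum_neg_distrib]
  linarith

theorem lintegral_pi_prod_eq_pow {α : Type*} [MeasurableSpace α] (μ : Measure α)
    [IsProbabilityMeasure μ] {f : α → ℝ≥0∞} (hf : Measurable f) (m : ℕ) :
    ∫⁻ x, ∏ i, f (x i) ∂(Measure.pi fun _ : Fin m => μ) = (∫⁻ a, f a ∂μ) ^ m := by
  rw [ProbabilityTheory.lintegral_prod_eq_prod_lintegral_of_indepFun Finset.univ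
    (fun i (x : Fin m → α) => f (x i))
    (ProbabilityTheory.iIndepFun_pi fun _ => hf.aemeasurable)
    fun i => hf.comp (measurable_pi_apply i),
    Finset.prod_congr rfl fun i _ =>
      (measurePreserving_eval (fun _ : Fin m => μ) i).lintegral_comp hf]
  simp

/-- The energy density `‖charFun μ η‖ ^ 2`, damped away from the orthogonal complement of the
vectors `x i`. -/
def dampedEnergy {V : Type*} [NormedAddCommGroup V] [InnerProductSpace ℝ V] [MeasurableSpace V]
    (μ : Measure V) (κ : ℝ) {m : ℕ} (x : Fin m → V) (η : V) : ℝ≥0∞ :=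
  (∏ i, ENNReal.ofReal (Real.exp (-(κ * ⟪x i, η⟫ ^ 2)))) * ‖charFun μ η‖ₑ ^ 2

theorem measurable_dampedEnergy (μ : Measure V) [SFinite μ] (κ : ℝ) (m : ℕ) :
    Measurable (Function.uncurry (dampedEnergy μ κ (m := m))) := by
  refine Measurable.mul (Finset.measurable_prod _ fun i _ => ?_) ?_
  · have : Continuous fun p : (Fin m → V) × V => Real.exp (-(κ * ⟪p.1 i, p.2⟫ ^ 2)) := by
      fun_prop
    exact this.measurable.ennreal_ofReal
  · exact (measurable_charFun.comp measurable_snd).enorm.pow_const 2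

theorem GaussianFrostman.ae_lintegral_dampedEnergy_lt_top {μ : Measure V}
    [IsProbabilityMeasure μ] {s C ρ κ : ℝ} (hC : 0 < C) (h : GaussianFrostman μ s C)
    (hκ : 0 < κ) (hκ2 : κ ≤ 2)
    (hρ : ∀ᵐ x ∂μ, ‖x‖ ≤ ρ) {m : ℕ} (hm : 0 < m) (hs : Module.finrank ℝ V - 1 < s)
    (hms : Module.finrank ℝ V - s < m * (s - (Module.finrank ℝ V - 1))) :
    ∀ᵐ x ∂(Measure.pi fun _ : Fin m => μ), ∫⁻ η : V, dampedEnergy μ κ x η < ∞ := by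
  obtain ⟨C', hC', hS⟩ := h.lintegral_exp_neg_inner_sq_le hC hκ hκ2 hs.le hρ
  have hFm := measurable_dampedEnergy μ κ m
  refine ae_lt_top hFm.lintegral_prod_right (LT.lt.ne ?_)
  rw [lintegral_lintegral_swap hFm.aemeasurable]
  have hprod : ∀ η : V, ∫⁻ x, dampedEnergy μ κ x η ∂(Measure.pi fun _ : Fin m => μ) =
      (∫⁻ x, ENNReal.ofReal (Real.exp (-(κ * ⟪x, η⟫ ^ 2))) ∂μ) ^ m * ‖charFun μ η‖ₑ ^ 2 := by
    intro η
    have hme : Measurable fun x : V => ENNReal.ofReal (Real.exp (-(κ * ⟪x, η⟫ ^ 2))) := by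
      fun_prop
    unfold dampedEnergy
    rw [lintegral_mul_const _ (by fun_prop), lintegral_pi_prod_eq_pow μ hme]
  simp_rw [hprod]
  have hp : 0 < m * (s - (Module.finrank ℝ V - 1)) / 2 := by
    have : 0 < s - (Module.finrank ℝ V - 1) := by linarith
    positivity
  have hlt := h.lintegral_charFun_sq_mul_rpow_lt_top hC hp (by linarith)
  calc _ ≤ ∫⁻ η : V, ENNReal.ofReal (C' ^ m) * (ENNReal.ofReal
        ((1 + ‖η‖ ^ 2) ^ (-(m * (s - (Module.finrank ℝ V - 1)) / 2))) * ‖charFun μ η‖ₑ ^ 2) := by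
        refine lintegral_mono fun η => ?_
        rw [← mul_assoc]
        refine mul_le_mul_left ((pow_le_pow_left₀ zero_le (hS η) m).trans (le_of_eq ?_)) _
        rw [← ENNReal.ofReal_pow (by positivity), ← ENNReal.ofReal_mul (by positivity), mul_pow,
          Real.sqrt_eq_rpow, ← Real.rpow_mul (by positivity), ← Real.rpow_natCast (_ ^ _ : ℝ) m,
          ← Real.rpow_mul (by positivity)]
        congr 3
        ring
    _ < ∞ := by
        rw [lintegral_const_mul' _ _ ENNReal.ofReal_ne_top]
        exact ENNReal.mul_lt_top ENNReal.ofReal_lt_top hlt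

theorem lintegral_sq_charFun_gaussianWeight_lt_top {μ : Measure V} [IsFiniteMeasure μ]
    {m : ℕ} {κ ρ : ℝ} (hκ0 : 0 ≤ κ) (hκ : κ * (m * ρ ^ 2) ≤ 1 / 4) {x : Fin m → V}
    (hxρ : ∀ i, ‖x i‖ ≤ ρ) (hx : ∫⁻ η : V, dampedEnergy μ κ x η < ∞) {n : V} (hn : n ≠ 0)
    (hnx : ∀ i, ⟪n, x i⟫ = 0) :
    ∫⁻ t : ℝ, ‖charFun (gaussianWeight μ) (t • n)‖ₑ ^ 2 < ∞ := by
  obtain ⟨K, hK, hH⟩ := exists_sq_charFun_gaussianWeight_le μ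
  obtain ⟨L, hL, hLb⟩ := exists_lintegral_exp_neg_norm_sub_smul_sq_le hn
  have hle : ∀ (t : ℝ) (η : V), ENNReal.ofReal (Real.exp (-(1 / 2 * ‖η - t • n‖ ^ 2))) *
      ‖charFun μ η‖ₑ ^ 2 ≤
        ENNReal.ofReal (Real.exp (-(1 / 4 * ‖η - t • n‖ ^ 2))) * dampedEnergy μ κ x η := by
    intro t η
    rw [dampedEnergy, ← ENNReal.ofReal_prod_of_nonneg fun i _ => (Real.exp_pos _).le, ← mul_assoc,
      ← ENNReal.ofReal_mul (by positivity)]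
    gcongr
    exact exp_neg_norm_sub_smul_sq_le hκ0 hκ hxρ hnx η t
  have hFx : Measurable (dampedEnergy μ κ x) :=
    (measurable_dampedEnergy μ κ m).of_uncurry_left
  calc _ ≤ ∫⁻ t : ℝ, K * ∫⁻ η : V,
        ENNReal.ofReal (Real.exp (-(1 / 4 * ‖η - t • n‖ ^ 2))) * dampedEnergy μ κ x η := by
        exact lintegral_mono fun t => (hH _).trans (mul_le_mul_right (lintegral_mono (hle t)) K)
    _ = K * ∫⁻ η : V, ∫⁻ t : ℝ,
        ENNReal.ofReal (Real.exp (-(1 / 4 * ‖η - t • n‖ ^ 2))) * dampedEnergy μ κ x η := by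
        rw [lintegral_const_mul' _ _ hK, lintegral_lintegral_swap]
        refine Measurable.aemeasurable (Measurable.mul ?_ (hFx.comp measurable_snd))
        have : Continuous fun p : ℝ × V => Real.exp (-(1 / 4 * ‖p.2 - p.1 • n‖ ^ 2)) := by
          fun_prop
        exact this.measurable.ennreal_ofReal
    _ ≤ K * ∫⁻ η : V, L * dampedEnergy μ κ x η := by
        gcongr with η
        rw [lintegral_mul_const _ (by fun_prop)]
        gcongr
        exact hLb η
    _ < ∞ := by
        rw [lintegral_const_mul' _ _ hL]
        exact ENNReal.mul_lt_top hK.lt_top (ENNReal.mul_lt_top hL.lt_top hx)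

theorem GaussianFrostman.ae_lintegral_sq_charFun_gaussianWeight_lt_top {μ : Measure V}
    [IsProbabilityMeasure μ] {s C ρ : ℝ} (hC : 0 < C) (h : GaussianFrostman μ s C)
    (hρ : ∀ᵐ x ∂μ, ‖x‖ ≤ ρ) {m : ℕ} (hm : 0 < m) (hs : Module.finrank ℝ V - 1 < s)
    (hms : Module.finrank ℝ V - s < m * (s - (Module.finrank ℝ V - 1))) :
    ∀ᵐ x ∂(Measure.pi fun _ : Fin m => μ), ∀ n : V, n ≠ 0 → (∀ i, ⟪n, x i⟫ = 0) →
      ∫⁻ t : ℝ, ‖charFun (gaussianWeight μ) (t • n)‖ₑ ^ 2 < ∞ := by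
  obtain ⟨κ, hκ0, hκ2, hκ⟩ : ∃ κ : ℝ, 0 < κ ∧ κ ≤ 2 ∧ κ * (m * ρ ^ 2) ≤ 1 / 4 := by
    have h0 : (0 : ℝ) ≤ m * ρ ^ 2 := by positivity
    generalize (m * ρ ^ 2 : ℝ) = a at h0
    refine ⟨1 / (4 * (a + 1)), by positivity, ?_, ?_⟩
    · rw [div_le_iff₀ (by positivity)]
      linarith
    · rw [div_mul_eq_mul_div, div_le_div_iff₀ (by positivity) (by positivity)]
      linarith
  have hρ' : ∀ᵐ x ∂(Measure.pi fun _ : Fin m => μ), ∀ i, ‖x i‖ ≤ ρ :=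
    ae_all_iff.2 fun i => (Measure.quasiMeasurePreserving_eval (fun _ : Fin m => μ) i).ae hρ
  filter_upwards [h.ae_lintegral_dampedEnergy_lt_top hC hκ0 hκ2 hρ hm hs hms, hρ']
    with x hx hxρ n hn hnx
  exact lintegral_sq_charFun_gaussianWeight_lt_top hκ0.le hκ hxρ hx hn hnx

section AbsolutelyContinuous

open scoped SchwartzMap FourierTransform Manifold

theorem SchwartzMap.integral_eq_integral_fourierInv_mul_charFun (ν : Measure ℝ) [IsFiniteMeasure ν]
    (φ : 𝓢(ℝ, ℂ)) : ∫ x, φ x ∂ν = ∫ t : ℝ, 𝓕⁻ φ t * charFun ν (-(2 * Real.pi * t)) := by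
  have hφ : ∀ x, φ x = ∫ t : ℝ, 𝓕⁻ φ t * Complex.exp (⟪x, -(2 * Real.pi * t)⟫ * Complex.I) := by
    intro x
    have h0 : 𝓕 (𝓕⁻ φ) = φ := FourierTransform.fourier_fourierInv_eq φ
    conv_lhs => rw [← h0]
    rw [SchwartzMap.fourier_coe, Real.fourier_real_eq_integral_exp_smul]
    refine integral_congr_ae (Filter.Eventually.of_forall fun t => ?_)
    simp only [smul_eq_mul, mul_comm (𝓕⁻ φ t)]
    congr 3
    simp
  simp_rw [charFun_apply, ← integral_const_mul]
  rw [integral_integral_swap]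
  · exact integral_congr_ae (Filter.Eventually.of_forall hφ)
  · have h1 : Integrable (fun p : ℝ × ℝ => 𝓕⁻ φ p.1) (volume.prod ν) :=
      (𝓕⁻ φ).integrable.comp_fst ν
    refine h1.norm.mono' ?_ (Filter.Eventually.of_forall fun p => ?_)
    · have h2 : Continuous fun p : ℝ × ℝ =>
          Complex.exp (⟪p.2, -(2 * Real.pi * p.1)⟫ * Complex.I) := by fun_prop
      exact h1.aestronglyMeasurable.mul h2.aestronglyMeasurable
    · simp only [Function.uncurry, norm_mul, Complex.norm_exp_ofReal_mul_I, mul_one, le_refl]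

theorem SchwartzMap.lintegral_enorm_sq (φ : 𝓢(ℝ, ℂ)) :
    ∫⁻ t, ‖φ t‖ₑ ^ 2 = ENNReal.ofReal (∫ t, ‖φ t‖ ^ 2) := by
  rw [ofReal_integral_eq_lintegral_ofReal]
  · refine lintegral_congr fun t => ?_
    rw [ENNReal.ofReal_pow (norm_nonneg _), ofReal_norm]
  · exact (memLp_two_iff_integrable_sq_norm φ.continuous.aestronglyMeasurable).1 (φ.memLp 2)
  · exact Filter.Eventually.of_forall fun t => by positivity

theorem SchwartzMap.enorm_integral_sq_le (ν : Measure ℝ) [IsFiniteMeasure ν] (φ : 𝓢(ℝ, ℂ)) :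
    ‖∫ x, φ x ∂ν‖ₑ ^ 2 ≤
      (∫⁻ x, ‖φ x‖ₑ ^ 2) * ∫⁻ t : ℝ, ‖charFun ν (-(2 * Real.pi * t))‖ₑ ^ 2 := by
  have hm : Measurable fun t : ℝ => charFun ν (-(2 * Real.pi * t)) :=
    measurable_charFun.comp (by fun_prop)
  have hpl : ∫⁻ x, ‖φ x‖ₑ ^ 2 = ∫⁻ t, ‖𝓕⁻ φ t‖ₑ ^ 2 := by
    rw [SchwartzMap.lintegral_enorm_sq, SchwartzMap.lintegral_enorm_sq,
      ← SchwartzMap.integral_norm_sq_fourier (𝓕⁻ φ), FourierTransform.fourier_fourierInv_eq]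
  rw [hpl, φ.integral_eq_integral_fourierInv_mul_charFun ν]
  refine le_trans ?_ (sq_lintegral_mul_le (𝓕⁻ φ).continuous.measurable.enorm.aemeasurable
    hm.enorm.aemeasurable)
  gcongr
  refine (enorm_integral_le_lintegral_enorm _).trans (le_of_eq (lintegral_congr fun t => ?_))
  rw [enorm_mul]

theorem measure_sq_le_mul_lintegral_sq_charFun {ν : Measure ℝ} [IsFiniteMeasure ν] {K U : Set ℝ}
    (hK : IsCompact K) (hU : IsOpen U) (hKU : K ⊆ U) :
    ν K ^ 2 ≤ volume U * ∫⁻ t : ℝ, ‖charFun ν (-(2 * Real.pi * t))‖ₑ ^ 2 := by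
  obtain ⟨r, hr⟩ := hK.isBounded.subset_ball 0
  obtain ⟨f, hf, hf01, hfU, hfK⟩ := exists_contMDiff_support_eq_eq_one_iff 𝓘(ℝ, ℝ) (n := ⊤)
    (hU.inter (isOpen_ball (x := (0 : ℝ)) (ε := r))) hK.isClosed (Set.subset_inter hKU hr)
  have hfc : HasCompactSupport f := by
    refine HasCompactSupport.of_support_subset_isCompact (isCompact_closedBall (0 : ℝ) r) ?_
    rw [hfU]
    exact Set.inter_subset_right.trans ball_subset_closedBall
  have hf01' : ∀ x, 0 ≤ f x ∧ f x ≤ 1 := fun x => hf01 (Set.mem_range_self x)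
  have hgc : HasCompactSupport fun x => (f x : ℂ) := hfc.comp_left (g := Complex.ofReal) (by simp)
  have hgs : ContDiff ℝ (⊤ : ℕ∞) fun x => (f x : ℂ) :=
    Complex.ofRealCLM.contDiff.comp (contMDiff_iff_contDiff.1 hf)
  have h := SchwartzMap.enorm_integral_sq_le ν (hgc.toSchwartzMap hgs)
  simp only [HasCompactSupport.toSchwartzMap_toFun] at h
  have hfm : Measurable f := hf.continuous.measurable
  have he : ∀ x, ‖(f x : ℂ)‖ₑ = ENNReal.ofReal (f x) := fun x => by
    rw [← ofReal_norm, Complex.norm_real, Real.norm_of_nonneg (hf01' x).1]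
  have h1 : ν K ≤ ‖∫ x, (f x : ℂ) ∂ν‖ₑ := by
    rw [integral_complex_ofReal, ← ofReal_norm, Complex.norm_real,
      Real.norm_of_nonneg (integral_nonneg fun x => (hf01' x).1),
      ofReal_integral_eq_lintegral_ofReal
        (hf.continuous.integrable_of_hasCompactSupport hfc)
        (Filter.Eventually.of_forall fun x => (hf01' x).1),
      ← lintegral_indicator_one hK.measurableSet]
    refine lintegral_mono fun x => ?_
    by_cases hx : x ∈ K
    · simp [hx, (hfK x).1 hx]
    · simp [hx]
  have h2 : ∫⁻ x, ‖(f x : ℂ)‖ₑ ^ 2 ≤ volume U := by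
    rw [← lintegral_indicator_one hU.measurableSet]
    refine lintegral_mono fun x => ?_
    by_cases hx : x ∈ U
    · rw [Set.indicator_of_mem hx, he]
      exact pow_le_one₀ zero_le (ENNReal.ofReal_le_one.2 (hf01' x).2)
    · have : f x = 0 := by
        by_contra h0
        have : x ∈ Function.support f := h0
        rw [hfU] at this
        exact hx this.1
      simp [this]
  calc ν K ^ 2 ≤ ‖∫ x, (f x : ℂ) ∂ν‖ₑ ^ 2 := by gcongr
    _ ≤ _ := h
    _ ≤ _ := by gcongr

/-- A finite measure on the line with square integrable Fourier transform is absolutely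
continuous. -/
theorem absolutelyContinuous_of_lintegral_sq_charFun_lt_top {ν : Measure ℝ} [IsFiniteMeasure ν]
    (h : ∫⁻ t : ℝ, ‖charFun ν t‖ₑ ^ 2 < ∞) : ν ≪ volume := by
  have h' : ∫⁻ t : ℝ, ‖charFun ν (-(2 * Real.pi * t))‖ₑ ^ 2 ≠ ∞ := by
    have hc : -(2 * Real.pi) ≠ 0 := by simp [Real.pi_ne_zero]
    have hm : Measurable fun t : ℝ => ‖charFun ν t‖ₑ ^ 2 := measurable_charFun.enorm.pow_const 2
    have h2 := lintegral_map (μ := volume) hm (measurable_const_mul (-(2 * Real.pi)))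
    rw [Real.map_volume_mul_left hc, lintegral_smul_measure] at h2
    simp only [neg_mul] at h2
    rw [← h2]
    exact ENNReal.mul_ne_top ENNReal.ofReal_ne_top h.ne
  refine Measure.AbsolutelyContinuous.mk fun N hN hN0 => ?_
  rw [hN.measure_eq_iSup_isCompact]
  simp only [ENNReal.iSup_eq_zero]
  intro K hKN hK
  have hK0 : volume K = 0 := measure_mono_null hKN hN0
  by_contra hν
  set M := ∫⁻ t : ℝ, ‖charFun ν (-(2 * Real.pi * t))‖ₑ ^ 2
  have hpos : 0 < ν K ^ 2 := ENNReal.pow_pos (pos_iff_ne_zero.2 hν) 2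
  obtain ⟨U, hKU, hU, hUlt⟩ := K.exists_isOpen_lt_of_lt (μ := volume) (ν K ^ 2 / (M + 1)) (by
    rw [hK0]
    exact ENNReal.div_pos hpos.ne' (by simp [h']))
  have h3 := measure_sq_le_mul_lintegral_sq_charFun (ν := ν) hK hU hKU
  have h4 := ENNReal.mul_lt_of_lt_div hUlt
  refine absurd (h3.trans (mul_le_mul_right (le_self_add : M ≤ M + 1) _)) (not_le.2 h4)

end AbsolutelyContinuous

theorem GaussianFrostman.measure_inner_eq_zero {μ : Measure V} [SFinite μ] {s C ρ : ℝ} (hC : 0 < C)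
    (h : GaussianFrostman μ s C) (hs : Module.finrank ℝ V - 1 < s) (hρ : ∀ᵐ x ∂μ, ‖x‖ ≤ ρ)
    {e : V} (he : e ≠ 0) : μ {x | ⟪x, e⟫ = 0} = 0 := by
  obtain ⟨C', hC', hS⟩ := h.lintegral_exp_neg_inner_sq_le hC one_pos one_le_two hs.le hρ
  have hle : ∀ t : ℝ, μ {x | ⟪x, e⟫ = 0} ≤ ENNReal.ofReal
      (C' * √(1 + ‖t • e‖ ^ 2) ^ (-(s - (Module.finrank ℝ V - 1)))) := by
    intro t
    rw [show -(s - (Module.finrank ℝ V - 1)) = Module.finrank ℝ V - 1 - s by ring]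
    refine le_trans ?_ (hS (t • e))
    have hm : MeasurableSet {x : V | ⟪x, e⟫ = 0} :=
      (isClosed_eq (by fun_prop) continuous_const).measurableSet
    rw [← lintegral_indicator_one hm]
    refine lintegral_mono fun x => ?_
    by_cases hx : ⟪x, e⟫ = 0
    · simp [hx, inner_smul_right]
    · simp [hx]
  have hlim : Filter.Tendsto (fun t : ℝ => ENNReal.ofReal
      (C' * √(1 + ‖t • e‖ ^ 2) ^ (-(s - (Module.finrank ℝ V - 1))))) Filter.atTop (nhds 0) := by
    rw [← ENNReal.ofReal_zero, ← mul_zero C']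
    refine ENNReal.tendsto_ofReal (Filter.Tendsto.const_mul C'
      ((tendsto_rpow_neg_atTop (by linarith)).comp ?_))
    refine Filter.tendsto_atTop_mono' _ ?_
      (Filter.tendsto_id.atTop_mul_const (norm_pos_iff.2 he))
    filter_upwards [Filter.eventually_ge_atTop 0] with t ht
    refine Real.le_sqrt_of_sq_le ?_
    rw [norm_smul, Real.norm_of_nonneg ht]
    simp
  exact le_antisymm (ge_of_tendsto' hlim hle) zero_le

theorem absolutelyContinuous_map_inner {μ : Measure V} [IsFiniteMeasure μ] {n : V}
    (h : ∫⁻ t : ℝ, ‖charFun (gaussianWeight μ) (t • n)‖ₑ ^ 2 < ∞) :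
    μ.map (fun y => ⟪n, y⟫) ≪ volume := by
  have hm : Measurable fun y : V => ⟪n, y⟫ := by fun_prop
  refine ((absolutelyContinuous_gaussianWeight μ).map hm).trans
    (absolutelyContinuous_of_lintegral_sq_charFun_lt_top ?_)
  refine lt_of_eq_of_lt (lintegral_congr fun t => ?_) h
  rw [charFun_apply, charFun_apply, integral_map hm.aemeasurable (by fun_prop)]
  congr 3
  funext y
  simp [inner_smul_right, real_inner_comm n y, mul_comm]

end InnerProduct

section Determinant

theorem detCols_ne_zero {d : ℕ} {x : Fin d → EuclideanSpace ℝ (Fin d)}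
    (hx : LinearIndependent ℝ x) : detCols x ≠ 0 := by
  have h : LinearIndependent ℝ (Matrix.of fun l i => x i l : Matrix (Fin d) (Fin d) ℝ).col :=
    hx.map' (WithLp.linearEquiv 2 ℝ (Fin d → ℝ)).toLinearMap (LinearEquiv.ker _)
  rw [Matrix.linearIndependent_cols_iff_isUnit, Matrix.isUnit_iff_isUnit_det] at h
  exact h.ne_zero

/-- `detCols` as an alternating map. -/
def detColsAlternating (d : ℕ) : EuclideanSpace ℝ (Fin d) [⋀^Fin d]→ₗ[ℝ] ℝ :=
  Matrix.detRowAlternating.compLinearMap (WithLp.linearEquiv 2 ℝ (Fin d → ℝ)).toLinearMap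

theorem detColsAlternating_apply {d : ℕ} (x : Fin d → EuclideanSpace ℝ (Fin d)) :
    detColsAlternating d x = detCols x := by
  rw [detCols, ← Matrix.det_transpose]
  rfl

/-- The generalized cross product of `x 0, …, x (m - 1)`. -/
theorem exists_inner_eq_detCols_snoc {m : ℕ} (x : Fin m → EuclideanSpace ℝ (Fin (m + 1))) :
    ∃ n : EuclideanSpace ℝ (Fin (m + 1)),
      ∀ y, ⟪n, y⟫ = detCols (Fin.snoc x y : Fin (m + 1) → EuclideanSpace ℝ (Fin (m + 1))) := by
  let L := (detColsAlternating (m + 1)).toMultilinearMap.toLinearMap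
    (Fin.snoc x 0 : Fin (m + 1) → EuclideanSpace ℝ (Fin (m + 1))) (Fin.last m)
  refine ⟨(InnerProductSpace.toDual ℝ _).symm L.toContinuousLinearMap, fun y => ?_⟩
  rw [InnerProductSpace.toDual_symm_apply, ← detColsAlternating_apply]
  simp [L, Fin.update_snoc_last]

theorem detCols_snoc_apply_eq_zero {m : ℕ} (x : Fin m → EuclideanSpace ℝ (Fin (m + 1)))
    (i : Fin m) :
    detCols (Fin.snoc x (x i) : Fin (m + 1) → EuclideanSpace ℝ (Fin (m + 1))) = 0 := by
  rw [← detColsAlternating_apply]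
  refine AlternatingMap.map_eq_zero_of_eq _ _ (i := i.castSucc) (j := Fin.last m) ?_
    (Fin.castSucc_lt_last i).ne
  simp

theorem exists_detCols_snoc_ne_zero {m : ℕ} {x : Fin m → EuclideanSpace ℝ (Fin (m + 1))}
    (hx : LinearIndependent ℝ x) : ∃ y,
      detCols (Fin.snoc x y : Fin (m + 1) → EuclideanSpace ℝ (Fin (m + 1))) ≠ 0 := by
  obtain ⟨y, hy⟩ : ∃ y, y ∉ Submodule.span ℝ (Set.range x) := by
    by_contra! h
    have h1 : Submodule.span ℝ (Set.range x) = ⊤ := Submodule.eq_top_iff'.2 h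
    have h2 := finrank_range_le_card (R := ℝ) x
    rw [Set.finrank, h1, finrank_top, finrank_euclideanSpace_fin, Fintype.card_fin] at h2
    omega
  exact ⟨y, detCols_ne_zero (linearIndependent_finSnoc.2 ⟨hx, hy⟩)⟩

end Determinant

theorem ae_linearIndependent {V : Type*} [NormedAddCommGroup V] [InnerProductSpace ℝ V]
    [FiniteDimensional ℝ V] [MeasurableSpace V] [BorelSpace V] (μ : Measure V)
    [IsProbabilityMeasure μ] (hμ : ∀ e : V, e ≠ 0 → μ {x | ⟪x, e⟫ = 0} = 0) {m : ℕ}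
    (hm : m ≤ Module.finrank ℝ V) :
    ∀ᵐ x ∂(Measure.pi fun _ : Fin m => μ), LinearIndependent ℝ x := by
  induction m with
  | zero => exact Filter.Eventually.of_forall fun x => linearIndependent_empty_type
  | succ m ih =>
    specialize ih (by omega)
    have hmeas : MeasurableSet {p : V × (Fin m → V) |
        LinearIndependent ℝ (Fin.cons p.1 p.2 : Fin (m + 1) → V)} := by
      have h1 : IsOpen {x : Fin (m + 1) → V | LinearIndependent ℝ x} :=
        isOpen_setOfPred_linearIndependent
      have h2 : Continuous fun p : V × (Fin m → V) => (Fin.cons p.1 p.2 : Fin (m + 1) → V) := by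
        fun_prop
      exact (h1.preimage h2).measurableSet
    have hprod : ∀ᵐ p ∂(μ.prod (Measure.pi fun _ : Fin m => μ)),
        LinearIndependent ℝ (Fin.cons p.1 p.2 : Fin (m + 1) → V) := by
      rw [Measure.ae_prod_iff_ae_ae hmeas, Measure.ae_ae_comm hmeas]
      filter_upwards [ih] with x hx
      have hlt : Submodule.span ℝ (Set.range x) ≠ ⊤ := by
        intro h1
        have h2 := finrank_range_le_card (R := ℝ) x
        rw [Set.finrank, h1, finrank_top, Fintype.card_fin] at h2
        omega
      obtain ⟨e, he, he0⟩ := Submodule.exists_mem_ne_zero_of_ne_bot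
        (mt Submodule.orthogonal_eq_bot_iff.1 hlt)
      have h3 : ∀ᵐ y ∂μ, ⟪y, e⟫ ≠ 0 := by simpa [ae_iff] using hμ e he0
      filter_upwards [h3] with y hy
      exact linearIndependent_finCons.2 ⟨hx, fun hys => hy (he y hys)⟩
    have := (measurePreserving_piFinSuccAbove (fun _ : Fin (m + 1) => μ) 0).quasiMeasurePreserving.ae
      hprod
    filter_upwards [this] with x hx
    have hx' : (Fin.cons (x 0) (fun i => x (Fin.succ i)) : Fin (m + 1) → V) = x :=
      Fin.cons_self_tail x
    rw [← hx']
    exact hx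

section Chain

/-- The chains of volumes that continue the points `x 0, …, x (m - 1)` by `N` points of `E`. -/
def chainSet {m : ℕ} (E : Set (EuclideanSpace ℝ (Fin (m + 1)))) :
    (N : ℕ) → (Fin m → EuclideanSpace ℝ (Fin (m + 1))) → Set (Fin N → ℝ)
  | 0, _ => Set.univ
  | N + 1, x => {v | ∃ y ∈ E,
      v 0 = detCols (Fin.snoc x y : Fin (m + 1) → EuclideanSpace ℝ (Fin (m + 1))) ∧
        Fin.tail v ∈ chainSet E N
          (Fin.tail (Fin.snoc x y : Fin (m + 1) → EuclideanSpace ℝ (Fin (m + 1))))}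

theorem exists_seq_of_mem_chainSet {m : ℕ} {E : Set (EuclideanSpace ℝ (Fin (m + 1)))} {N : ℕ}
    {x : Fin m → EuclideanSpace ℝ (Fin (m + 1))} (hx : ∀ i, x i ∈ E) {v : Fin N → ℝ}
    (hv : v ∈ chainSet E N x) : ∃ z : ℕ → EuclideanSpace ℝ (Fin (m + 1)),
      (∀ i : Fin m, z i = x i) ∧ (∀ i < m + N, z i ∈ E) ∧
        ∀ j : Fin N, v j = detCols fun i : Fin (m + 1) => z (j + i) := by
  induction N generalizing x with
  | zero =>
    refine ⟨fun i => if h : i < m then x ⟨i, h⟩ else 0, fun i => by simp, fun i hi => ?_,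
      fun j => j.elim0⟩
    have hi : i < m := hi
    simp [hi, hx]
  | succ N ih =>
    obtain ⟨y, hy, hv0, hvt⟩ := hv
    set w : Fin (m + 1) → EuclideanSpace ℝ (Fin (m + 1)) := Fin.snoc x y with hw
    have hwE : ∀ i, w i ∈ E := by
      intro i
      refine Fin.lastCases ?_ (fun i => ?_) i
      · simpa [hw] using hy
      · simpa [hw] using hx i
    obtain ⟨z, hz, hzE, hzv⟩ := ih (x := Fin.tail w) (fun i => hwE i.succ) hvt
    let z' : ℕ → EuclideanSpace ℝ (Fin (m + 1)) := fun i => Nat.casesOn i (w 0) z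
    have hz' : ∀ i : Fin (m + 1), z' i = w i := by
      intro i
      refine Fin.cases rfl (fun i => ?_) i
      exact hz i
    refine ⟨z', fun i => ?_, fun i hi => ?_, fun j => ?_⟩
    · have := hz' i.castSucc
      simpa [hw] using this
    · cases i with
      | zero => exact hwE 0
      | succ i => exact hzE i (by omega)
    · refine Fin.cases ?_ (fun j => ?_) j
      · rw [hv0]
        congr 1
        funext i
        simpa using (hz' i).symm
      · have := hzv j
        rw [Fin.tail] at this
        rw [this]
        congr 1
        funext i
        rw [Fin.val_succ, add_right_comm]

theorem ae_ae_tail_snoc {α : Type*} [MeasurableSpace α] {μ : Measure α} [IsProbabilityMeasure μ]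
    {m : ℕ} {P : (Fin m → α) → Prop} (h : ∀ᵐ x ∂(Measure.pi fun _ : Fin m => μ), P x) :
    ∀ᵐ x ∂(Measure.pi fun _ : Fin m => μ), ∀ᵐ y ∂μ, P (Fin.tail (Fin.snoc x y : Fin (m + 1) → α)) := by
  have h0 := measurePreserving_piFinSuccAbove (fun _ : Fin (m + 1) => μ) 0
  have h1 := (measurePreserving_piFinSuccAbove (fun _ : Fin (m + 1) => μ) (Fin.last m)).symm
  have h2 := Measure.measurePreserving_swap (μ := Measure.pi fun _ : Fin m => μ) (ν := μ)
  have h3 := Measure.quasiMeasurePreserving_snd (μ := μ) (ν := Measure.pi fun _ : Fin m => μ)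
  have h4 := (h3.comp ((h0.comp (h1.comp h2)).quasiMeasurePreserving)).ae h
  filter_upwards [Measure.ae_ae_of_ae_prod h4] with x hx
  filter_upwards [hx] with y hy
  convert! hy using 1
  funext i
  simp [Fin.tail, MeasurableEquiv.piFinSuccAbove]

theorem ae_volume_chainSet_pos {m : ℕ} {E : Set (EuclideanSpace ℝ (Fin (m + 1)))}
    {μ : Measure (EuclideanSpace ℝ (Fin (m + 1)))} [IsProbabilityMeasure μ] (hμE : ∀ᵐ y ∂μ, y ∈ E)
    (h : ∀ᵐ x ∂(Measure.pi fun _ : Fin m => μ), ∃ n : EuclideanSpace ℝ (Fin (m + 1)),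
      (∀ y, ⟪n, y⟫ = detCols (Fin.snoc x y : Fin (m + 1) → EuclideanSpace ℝ (Fin (m + 1)))) ∧
        μ.map (fun y => ⟪n, y⟫) ≪ volume) (N : ℕ) :
    ∀ᵐ x ∂(Measure.pi fun _ : Fin m => μ), volume (chainSet E N x) ≠ 0 := by
  induction N with
  | zero =>
    exact Filter.Eventually.of_forall fun x =>
      (isOpen_univ.measure_pos (volume : Measure (Fin 0 → ℝ)) Set.univ_nonempty).ne'
  | succ N ih =>
    filter_upwards [h, ae_ae_tail_snoc ih] with x ⟨n, hn, hac⟩ hx h0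
    have h1 := (volume_preserving_piFinSuccAbove (fun _ : Fin (N + 1) => ℝ) 0).symm
    have h2 : ∀ᵐ p : ℝ × (Fin N → ℝ), (Fin.cons p.1 p.2 : Fin (N + 1) → ℝ) ∉ chainSet E (N + 1) x := by
      have h0' : ∀ᵐ v : Fin (N + 1) → ℝ, v ∉ chainSet E (N + 1) x := by
        simpa [ae_iff] using h0
      filter_upwards [h1.quasiMeasurePreserving.ae h0'] with p hp
      simpa using! hp
    have h3 := ae_of_ae_map (by fun_prop) (hac.ae_le (Measure.ae_ae_of_ae_prod h2))
    obtain ⟨y, hyE, hy0, hy1⟩ := (hμE.and (hx.and h3)).exists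
    refine hy0 (measure_mono_null (fun w hw => ?_) hy1)
    simp only [Set.mem_compl_iff, Set.mem_ofPred_eq, not_not]
    exact ⟨y, hyE, by simp [hn], by simpa using! hw⟩

end Chain

theorem exists_frostman_of_lt_dimH {d : ℕ} {E : Set (EuclideanSpace ℝ (Fin d))} (hE : IsCompact E)
    {a : ℝ} (ha : 0 ≤ a) (hdim : ENNReal.ofReal a < dimH E) :
    ∃ s : ℝ, a < s ∧ ∃ μ : Measure (EuclideanSpace ℝ (Fin d)), IsProbabilityMeasure μ ∧
      μ Eᶜ = 0 ∧ ∃ C, 0 < C ∧ GaussianFrostman μ s C := by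
  obtain ⟨s, hs, hsE⟩ := ENNReal.lt_iff_exists_nnreal_btwn.1 hdim
  have has : a < s := by
    rw [← ENNReal.ofReal_coe_nnreal] at hs
    exact (ENNReal.ofReal_lt_ofReal_iff_of_nonneg ha).1 hs
  obtain ⟨μ, hμ, hμE, C, hC, hball⟩ := exists_frostman_measure hE (ha.trans_lt has)
    (by rw [hausdorffMeasure_of_lt_dimH hsE]; exact ENNReal.top_ne_zero)
  exact ⟨s, has, μ, hμ, hμE, exists_gaussianFrostman_of_ball_le hC hball⟩

/-- Theorem: if `E ⊂ ℝ^d` is compact with `dimH E > d - 1 + 1/d`, then the set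
`C_{k,d}(E) ⊂ ℝ^{k+1-d}` of chains of volumes of `d` consecutive points of
`k`-point configurations in `E` has positive Lebesgue measure. -/
theorem chains_of_volumes_positive_measure (d k : ℕ) (hd : 2 ≤ d) (hk : d ≤ k)
    (E : Set (EuclideanSpace ℝ (Fin d))) (hE : IsCompact E)
    (hdim : ENNReal.ofReal ((d : ℝ) - 1 + 1 / (d : ℝ)) < dimH E) :
    0 < volume
      {v : EuclideanSpace ℝ (Fin (k + 1 - d)) |
        ∃ x : Fin k → EuclideanSpace ℝ (Fin d), (∀ i, x i ∈ E) ∧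
          ∀ j : Fin (k + 1 - d),
            v j = detCols fun i : Fin d =>
              x ⟨j.1 + i.1, by have h1 := j.2; have h2 := i.2; omega⟩} := by
  obtain ⟨m, rfl⟩ : ∃ m, d = m + 1 := ⟨d - 1, by omega⟩
  have hm : 0 < m := by omega
  have hdpos : (0 : ℝ) < ((m + 1 : ℕ) : ℝ) := by positivity
  have ha : (0 : ℝ) ≤ ((m + 1 : ℕ) : ℝ) - 1 + 1 / ((m + 1 : ℕ) : ℝ) := by
    push_cast
    rw [add_sub_cancel_right]
    positivity
  obtain ⟨s, hs, μ, hμ, hμE, C, hC, hF⟩ := exists_frostman_of_lt_dimH hE ha hdim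
  have hμE' : ∀ᵐ x ∂μ, x ∈ E := hμE
  obtain ⟨ρ, hρ⟩ := hE.isBounded.exists_norm_le
  have hρ' : ∀ᵐ x ∂μ, ‖x‖ ≤ ρ := hμE'.mono hρ
  have hs1 : (Module.finrank ℝ (EuclideanSpace ℝ (Fin (m + 1))) : ℝ) - 1 < s := by
    rw [finrank_euclideanSpace_fin]
    refine lt_of_le_of_lt ?_ hs
    have : 0 ≤ 1 / ((m + 1 : ℕ) : ℝ) := by positivity
    linarith
  have hs2 : (Module.finrank ℝ (EuclideanSpace ℝ (Fin (m + 1))) : ℝ) - s <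
      m * (s - ((Module.finrank ℝ (EuclideanSpace ℝ (Fin (m + 1))) : ℝ) - 1)) := by
    rw [finrank_euclideanSpace_fin]
    have h1 : 1 / ((m + 1 : ℕ) : ℝ) < s - (((m + 1 : ℕ) : ℝ) - 1) := by linarith
    rw [div_lt_iff₀ hdpos] at h1
    push_cast at h1 ⊢
    linarith
  have hgood : ∀ᵐ x ∂(Measure.pi fun _ : Fin m => μ), ∃ n : EuclideanSpace ℝ (Fin (m + 1)),
      (∀ y, ⟪n, y⟫ = detCols (Fin.snoc x y : Fin (m + 1) → EuclideanSpace ℝ (Fin (m + 1)))) ∧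
        μ.map (fun y => ⟪n, y⟫) ≪ volume := by
    filter_upwards [ae_linearIndependent μ (fun e he => hF.measure_inner_eq_zero hC hs1 hρ' he)
        (m := m) (by simp), hF.ae_lintegral_sq_charFun_gaussianWeight_lt_top hC hρ' hm hs1 hs2]
      with x hx hxn
    obtain ⟨n, hn⟩ := exists_inner_eq_detCols_snoc x
    obtain ⟨y, hy⟩ := exists_detCols_snoc_ne_zero hx
    have hn0 : n ≠ 0 := by
      rintro rfl
      exact hy (by rw [← hn, inner_zero_left])
    exact ⟨n, hn, absolutelyContinuous_map_inner
      (hxn n hn0 fun i => by rw [hn, detCols_snoc_apply_eq_zero])⟩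
  have hxE : ∀ᵐ x ∂(Measure.pi fun _ : Fin m => μ), ∀ i, x i ∈ E :=
    ae_all_iff.2 fun i => (Measure.quasiMeasurePreserving_eval (fun _ : Fin m => μ) i).ae hμE'
  obtain ⟨x, hxC, hxE⟩ :=
    ((ae_volume_chainSet_pos hμE' hgood (k + 1 - (m + 1))).and hxE).exists
  rw [pos_iff_ne_zero]
  intro h0
  have h1 : ∀ᵐ v : EuclideanSpace ℝ (Fin (k + 1 - (m + 1))), WithLp.ofLp v ∉
      chainSet E (k + 1 - (m + 1)) x := by
    refine measure_mono_null (fun v hv => ?_) h0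
    obtain ⟨z, -, hzE, hz⟩ := exists_seq_of_mem_chainSet hxE (not_not.1 hv)
    exact ⟨fun i => z i, fun i => hzE i (by omega), hz⟩
  refine hxC (measure_mono_null (fun v hv => ?_)
    ((PiLp.volume_preserving_toLp (Fin (k + 1 - (m + 1)))).quasiMeasurePreserving.ae h1))
  simpa using! hv
end
end

section
/- Let n, m, d, k ≥ 1 be integers. Let M ⊂ ℝ^m be a set for which there exist constants 0 < c₁ ≤ C₁ and r₀ > 0 with c₁ r^n ≤ H^n(M ∩ B(p,r)) ≤ C₁ r^n for all p ∈ M and 0 < r ≤ r₀, where H^n is n-dimensional Hausdorff measure. Let E ⊂ ℝ^d be compact, let Φ : (ℝ^d)^k → ℝ^m be continuous with Φ(E^k) ⊆ M, and let μ be a Borel probability measure supported on E. If there exists A > 0 such that ε^{−n} (μ^k ⊗ μ^k)({(x,y) ∈ (ℝ^d)^k × (ℝ^d)^k : |Φ(x) − Φ(y)| ≤ ε}) ≤ A for all ε ∈ (0,1], then H^n(Φ(E^k)) > 0. -/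
open MeasureTheory Metric
open scoped ENNReal

noncomputable section

/-- A nonzero measure with finite `n`-energy at all small scales cannot have infinite lower
`n`-density almost everywhere. -/
theorem not_ae_tendsto_div_measure_closedBall_zero
    {X : Type*} [PseudoMetricSpace X] [SecondCountableTopology X] [MeasurableSpace X]
    [BorelSpace X] (ν : Measure X) [SFinite ν] (hν : ν ≠ 0) (n : ℕ) {A c : ℝ} (hc : 0 < c)
    (henergy : ∀ ε : ℝ, 0 < ε → ε ≤ 1 →
      (ν.prod ν) {p : X × X | dist p.1 p.2 ≤ ε} ≤ ENNReal.ofReal (A * ε ^ n)) :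
    ¬ ∀ᵐ u ∂ν, Filter.Tendsto (fun r : ℝ => ENNReal.ofReal (c * r ^ n) / ν (closedBall u r))
      (nhdsWithin 0 (Set.Ioi 0)) (nhds 0) := by
  intro h
  set ε : ℕ → ℝ := fun j => 1 / ((j : ℝ) + 1) with hε
  have hεpos : ∀ j, 0 < ε j := fun j => Nat.one_div_pos_of_nat
  have hεle : ∀ j, ε j ≤ 1 := fun j => by
    rw [hε]
    exact (div_le_one (by positivity)).2 (by linarith [Nat.cast_nonneg (α := ℝ) j])
  have hεlim : Filter.Tendsto ε Filter.atTop (nhdsWithin 0 (Set.Ioi 0)) :=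
    tendsto_nhdsWithin_iff.2
      ⟨tendsto_one_div_add_atTop_nhds_zero_nat, Filter.Eventually.of_forall hεpos⟩
  have hset : ∀ r : ℝ, MeasurableSet {p : X × X | dist p.1 p.2 ≤ r} := fun r =>
    (isClosed_le continuous_dist continuous_const).measurableSet
  have hball : ∀ (r : ℝ) (u : X),
      Prod.mk u ⁻¹' {p : X × X | dist p.1 p.2 ≤ r} = closedBall u r := fun r u => by
    ext v; simp [dist_comm]
  have hmeas : ∀ r : ℝ, Measurable fun u => ν (closedBall u r) := fun r => by
    simpa only [hball] using measurable_measure_prodMk_left (ν := ν) (hset r)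
  let g : ℕ → X → ℝ≥0∞ := fun j u => ν (closedBall u (ε j)) / ENNReal.ofReal (c * ε j ^ n)
  have hpos : ∀ j, 0 < c * ε j ^ n := fun j => mul_pos hc (pow_pos (hεpos j) n)
  have hg : ∀ j, ∫⁻ u, g j u ∂ν ≤ ENNReal.ofReal (A / c) := fun j => by
    have hb := henergy (ε j) (hεpos j) (hεle j)
    rw [Measure.prod_apply (hset _)] at hb
    simp only [hball] at hb
    simp only [g, div_eq_mul_inv]
    rw [lintegral_mul_const _ (hmeas _), ← div_eq_mul_inv]
    refine (ENNReal.div_le_div_right hb _).trans_eq ?_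
    rw [← ENNReal.ofReal_div_of_pos (hpos j), mul_div_mul_right _ _ (pow_pos (hεpos j) n).ne',
      div_eq_mul_inv]
  have hlim : ∀ᵐ u ∂ν, Filter.liminf (fun j => g j u) Filter.atTop = ∞ := by
    filter_upwards [h] with u hu
    have h1 := tendsto_inv_iff.2 (hu.comp hεlim)
    rw [ENNReal.inv_zero] at h1
    refine Filter.Tendsto.liminf_eq (h1.congr fun j => ?_)
    exact ENNReal.inv_div (Or.inr ENNReal.ofReal_ne_top)
      (Or.inr (ENNReal.ofReal_pos.2 (hpos j)).ne')
  have hfatou := lintegral_liminf_le (μ := ν) (u := Filter.atTop) (f := g) fun j => (hmeas _).div_const _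
  rw [lintegral_congr_ae hlim, lintegral_const,
    ENNReal.top_mul (by simpa using hν), top_le_iff] at hfatou
  have hle : Filter.liminf (fun j => ∫⁻ u, g j u ∂ν) Filter.atTop ≤ ENNReal.ofReal (A / c) :=
    (Filter.liminf_le_liminf (Filter.Eventually.of_forall hg)).trans_eq
      (Filter.liminf_const _)
  rw [hfatou, top_le_iff] at hle
  exact ENNReal.ofReal_ne_top hle

/-- A measure that is uniformly finite on balls of a fixed radius centred at points of `M`
becomes locally finite when restricted to `M`. -/
theorem isLocallyFiniteMeasure_restrict_of_closedBall_lt_top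
    {X : Type*} [PseudoMetricSpace X] [MeasurableSpace X] [OpensMeasurableSpace X]
    (μ : Measure X) (M : Set X) {r : ℝ} (hr : 0 < r)
    (hM : ∀ p ∈ M, μ (M ∩ closedBall p r) < ∞) :
    IsLocallyFiniteMeasure (μ.restrict M) := by
  refine ⟨fun x => ⟨ball x (r / 2), ball_mem_nhds x (half_pos hr), ?_⟩⟩
  rw [Measure.restrict_apply measurableSet_ball]
  rcases (ball x (r / 2) ∩ M).eq_empty_or_nonempty with h | ⟨q, hqx, hqM⟩
  · simp [h]
  · refine (measure_mono ?_).trans_lt (hM q hqM)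
    rintro y ⟨hyx, hyM⟩
    refine ⟨hyM, ?_⟩
    rw [mem_ball] at hyx hqx
    rw [mem_closedBall]
    linarith [dist_triangle_right y q x]

/-- Abstract pushforward-measure lemma: if `M ⊂ ℝ^m` is locally Ahlfors
`n`-regular, `E ⊂ ℝ^d` is compact, `Φ : (ℝ^d)^k → ℝ^m` is continuous with
`Φ(E^k) ⊆ M`, `μ` is a Borel probability measure supported on `E`, and
`ε^{-n} (μ^k ⊗ μ^k){(x,y) : |Φ(x) - Φ(y)| ≤ ε} ≤ A` for all `0 < ε ≤ 1`, then
`H^n(Φ(E^k)) > 0`. -/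
theorem pushforward_l2_implies_positive_measure
    (n m d k : ℕ) (hn : 1 ≤ n) (hm : 1 ≤ m) (hd : 1 ≤ d) (hk : 1 ≤ k)
    (M : Set (EuclideanSpace ℝ (Fin m)))
    (c₁ C₁ r₀ : ℝ) (hc₁ : 0 < c₁) (hc₁C₁ : c₁ ≤ C₁) (hr₀ : 0 < r₀)
    (hreg : ∀ p ∈ M, ∀ r : ℝ, 0 < r → r ≤ r₀ →
      ENNReal.ofReal (c₁ * r ^ n) ≤ μH[(n : ℝ)] (M ∩ closedBall p r) ∧
        μH[(n : ℝ)] (M ∩ closedBall p r) ≤ ENNReal.ofReal (C₁ * r ^ n))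
    (E : Set (EuclideanSpace ℝ (Fin d))) (hE : IsCompact E)
    (Φ : (Fin k → EuclideanSpace ℝ (Fin d)) → EuclideanSpace ℝ (Fin m))
    (hΦ : Continuous Φ)
    (hΦM : ∀ x : Fin k → EuclideanSpace ℝ (Fin d), (∀ i, x i ∈ E) → Φ x ∈ M)
    (μ : Measure (EuclideanSpace ℝ (Fin d))) [IsProbabilityMeasure μ]
    (hsupp : μ Eᶜ = 0)
    (A : ℝ) (hA : 0 < A)
    (hbound : ∀ ε : ℝ, 0 < ε → ε ≤ 1 →
      ((Measure.pi fun _ : Fin k => μ).prod (Measure.pi fun _ : Fin k => μ))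
          {p : (Fin k → EuclideanSpace ℝ (Fin d)) × (Fin k → EuclideanSpace ℝ (Fin d)) |
            dist (Φ p.1) (Φ p.2) ≤ ε} ≤
        ENNReal.ofReal (A * ε ^ n)) :
    0 < μH[(n : ℝ)] (Φ '' {x | ∀ i, x i ∈ E}) := by
  by_contra hzero
  rw [not_lt, nonpos_iff_eq_zero] at hzero
  set P : Measure (Fin k → EuclideanSpace ℝ (Fin d)) := Measure.pi fun _ => μ with hP
  set Q : Set (Fin k → EuclideanSpace ℝ (Fin d)) := {x | ∀ i, x i ∈ E} with hQ
  have hKcompact : IsCompact (Φ '' Q) := (isCompact_pi_infinite fun _ => hE).image hΦ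
  have hKmeas : MeasurableSet (Φ '' Q) := hKcompact.isClosed.measurableSet
  set ν := P.map Φ with hν
  have : IsProbabilityMeasure ν := Measure.isProbabilityMeasure_map hΦ.measurable.aemeasurable
  have hQae : ∀ᵐ x ∂P, x ∈ Q := by
    rw [hQ]
    refine ae_all_iff.2 fun i => ?_
    exact (measurePreserving_eval (fun _ : Fin k => μ) i).quasiMeasurePreserving.ae
      (mem_ae_iff.2 hsupp)
  have hνK : ∀ᵐ u ∂ν, u ∈ Φ '' Q :=
    (ae_map_iff hΦ.measurable.aemeasurable hKmeas).2
      (hQae.mono fun x hx => Set.mem_image_of_mem Φ hx)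
  set σ := (μH[(n : ℝ)] : Measure (EuclideanSpace ℝ (Fin m))).restrict M with hσ
  have : IsLocallyFiniteMeasure σ :=
    isLocallyFiniteMeasure_restrict_of_closedBall_lt_top _ M hr₀ fun p hp =>
      (hreg p hp r₀ hr₀ le_rfl).2.trans_lt ENNReal.ofReal_lt_top
  have hsing : σ ⟂ₘ ν :=
    ⟨Φ '' Q, hKmeas, nonpos_iff_eq_zero.1 ((Measure.restrict_apply_le _ _).trans_eq hzero), hνK⟩
  refine not_ae_tendsto_div_measure_closedBall_zero ν (IsProbabilityMeasure.ne_zero ν) n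
    (A := A) hc₁ (fun ε hε hε1 => ?_) ?_
  · rw [hν, Measure.map_prod_map _ _ hΦ.measurable hΦ.measurable,
      Measure.map_apply (hΦ.measurable.prodMap hΦ.measurable)
        (isClosed_le continuous_dist continuous_const).measurableSet]
    exact hbound ε hε hε1
  · filter_upwards [Besicovitch.ae_tendsto_rnDeriv σ ν, hsing.rnDeriv_ae_eq_zero, hνK]
      with u hu hu0 huK
    rw [hu0, Pi.zero_apply] at hu
    obtain ⟨x, hx, rfl⟩ := huK
    refine tendsto_of_tendsto_of_tendsto_of_le_of_le' tendsto_const_nhds hu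
      (Filter.Eventually.of_forall fun _ => zero_le) ?_
    filter_upwards [Ioc_mem_nhdsGT hr₀] with r hr
    refine ENNReal.div_le_div_right ?_ _
    rw [hσ, Measure.restrict_apply measurableSet_closedBall, Set.inter_comm]
    exact (hreg _ (hΦM x hx) r hr.1 hr.2).1
end
end
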